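/- Assume the blow-up setup with n/(n−2) < p ≤ (n+2)/(n−2), and assume in addition: d_k → 0; there is C₀ > 0 such that u_k(y) ≤ C₀ λ_k^{n/(q_k+1)} (1+λ_k|y−x_k|)^{2−n} for all y ∈ Ω and all k; and there is a continuous function U : ℝⁿ → (0,∞) with U(x) ≤ C₀(1+|x|)^{2−n} such that for every x ∈ ℝⁿ one has λ_k^{−n/(q_k+1)} u_k(λ_k^{−1}x + x_k) → U(x) as k → ∞ (the point λ_k^{−1}x + x_k lies in Ω for all large k). Set A_U := ∫_{ℝⁿ} U(y)^q dy. Then each v_k is differentiable on Ω and there is a sequence η_k ≥ 0 with η_k → 0 such that for all k and all x with |x−x_k| = 2d_k: |v_k(x) − A_U λ_k^{−n/(q_k+1)} G(x,x_k)| ≤ η_k λ_k^{−n/(q+1)} d_k^{−(n−2)} and |∇_x v_k(x) − A_U λ_k^{−n/(q_k+1)} ∇_x G(x,x_k)| ≤ η_k λ_k^{−n/(q+1)} d_k^{−(n−1)}. -/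

import Mathlib

open MeasureTheory Metric Filter Topology RealInnerProductSpace

noncomputable section

abbrev Euc (n : ℕ) := EuclideanSpace ℝ (Fin n)

noncomputable def surf (n : ℕ) : Measure (Euc n) := μH[(n : ℝ) - 1]

noncomputable def omegaSph (n : ℕ) : ℝ := (surf n (sphere (0 : Euc n) 1)).toReal

/-- `c_n = 1/((n-2) ω_{n-1})`. -/
noncomputable def cGreen (n : ℕ) : ℝ := 1 / (((n : ℝ) - 2) * omegaSph n)

/-- Laplacian on `ℝⁿ`. -/
noncomputable def lap (n : ℕ) (u : Euc n → ℝ) (x : Euc n) : ℝ :=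
  ∑ i : Fin n, fderiv ℝ (fun y => fderiv ℝ u y (EuclideanSpace.single i 1)) x
    (EuclideanSpace.single i 1)

/-- The blow-up setup: a bounded open set `Ω ⊆ ℝⁿ` with a Green-type kernel `G`
(with regular part `H`), exponents `p, q` on the critical hyperbola, perturbed exponents
`q_k` with `ε_k → 0`, positive solutions `(u_k, v_k)` of the integral form of the Lane–Emden
system, maximum values `λ_k` attained at `x_k`, with `λ_k → ∞`, `N_k = λ_k d_k → ∞` and
`λ_k^{ε_k}` bounded. -/
structure BlowupSetup (n : ℕ) where
  Ω : Set (Euc n)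
  hΩo : IsOpen Ω
  hΩb : Bornology.IsBounded Ω
  G : Euc n → Euc n → ℝ
  H : Euc n → Euc n → ℝ
  Gsymm : ∀ x y, G x y = G y x
  Gdecomp : ∀ x ∈ Ω, ∀ y ∈ Ω, x ≠ y →
    G x y = cGreen n * ‖x - y‖ ^ ((2 : ℝ) - n) - H x y
  Hharm : ∀ y ∈ Ω, ContDiffOn ℝ 2 (fun x => H x y) Ω ∧
    ∀ x ∈ Ω, lap n (fun z => H z y) x = 0
  Gpos : ∀ x ∈ Ω, ∀ y ∈ Ω, x ≠ y → 0 < G x y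
  Gle : ∀ x ∈ Ω, ∀ y ∈ Ω, x ≠ y → G x y ≤ cGreen n * ‖x - y‖ ^ ((2 : ℝ) - n)
  p : ℝ
  hp : 1 ≤ p
  q : ℝ
  hq : 0 < q
  hpq : 1 / (p + 1) + 1 / (q + 1) = ((n : ℝ) - 2) / n
  eps : ℕ → ℝ
  heps : ∀ k, 0 < eps k
  heps0 : Filter.Tendsto eps Filter.atTop (nhds 0)
  qk : ℕ → ℝ
  hqk : ∀ k, 0 < qk k
  hqk_eq : ∀ k, 1 / (p + 1) + 1 / (qk k + 1) = ((n : ℝ) - 2) / n + eps k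
  u : ℕ → Euc n → ℝ
  v : ℕ → Euc n → ℝ
  hu_cont : ∀ k, ContinuousOn (u k) Ω
  hv_cont : ∀ k, ContinuousOn (v k) Ω
  hu_pos : ∀ k, ∀ x ∈ Ω, 0 < u k x
  hv_pos : ∀ k, ∀ x ∈ Ω, 0 < v k x
  hu_eq : ∀ k, ∀ x ∈ Ω, u k x = ∫ y in Ω, G x y * (v k y) ^ p
  hv_eq : ∀ k, ∀ x ∈ Ω, v k x = ∫ y in Ω, G x y * (u k y) ^ qk k
  lam : ℕ → ℝ
  xk : ℕ → Euc n
  hxk : ∀ k, xk k ∈ Ω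
  hlam_eq : ∀ k,
    lam k = max ((v k (xk k)) ^ ((p + 1) / n)) ((u k (xk k)) ^ ((qk k + 1) / n))
  hlam_sup : ∀ k, ∀ x ∈ Ω,
    max ((v k x) ^ ((p + 1) / n)) ((u k x) ^ ((qk k + 1) / n)) ≤ lam k
  hlam_top : Filter.Tendsto lam Filter.atTop Filter.atTop
  hN_top : Filter.Tendsto (fun k => lam k * (Metric.infDist (xk k) (frontier Ω) / 4))
    Filter.atTop Filter.atTop
  hlam_eps : ∃ C : ℝ, ∀ k, lam k ^ eps k ≤ C

namespace BlowupSetup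

variable {n : ℕ}

/-- `d_k = dist(x_k, ∂Ω)/4`. -/
noncomputable def d (S : BlowupSetup n) (k : ℕ) : ℝ :=
  Metric.infDist (S.xk k) (frontier S.Ω) / 4

/-- `N_k = λ_k d_k`. -/
noncomputable def N (S : BlowupSetup n) (k : ℕ) : ℝ := S.lam k * S.d k

end BlowupSetup

/-- The radial bump `(1 - |y|²)₊`. -/
def quadBump {n : ℕ} (y : Euc n) : ℝ := max 0 (1 - ‖y‖ ^ 2)

lemma continuous_quadBump {n : ℕ} : Continuous (quadBump (n := n)) := by
  unfold quadBump; fun_prop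

lemma quadBump_nonneg {n : ℕ} (y : Euc n) : 0 ≤ quadBump y := le_max_left _ _

lemma quadBump_le_one {n : ℕ} (y : Euc n) : quadBump y ≤ 1 :=
  max_le zero_le_one (by nlinarith [sq_nonneg ‖y‖])

lemma quadBump_eq_zero {n : ℕ} {y : Euc n} (hy : 1 ≤ ‖y‖) : quadBump y = 0 :=
  max_eq_left (by nlinarith)

lemma hasCompactSupport_quadBump {n : ℕ} : HasCompactSupport (quadBump (n := n)) := by
  refine HasCompactSupport.of_support_subset_isCompact (isCompact_closedBall (0 : Euc n) 1) ?_
  intro y hy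
  rw [Function.mem_support] at hy
  rw [mem_closedBall_zero_iff]
  by_contra! h
  exact hy (quadBump_eq_zero h.le)

lemma abs_quadBump_sub_le {n : ℕ} (a b : Euc n) :
    |quadBump a - quadBump b| ≤ 2 * ‖a - b‖ := by
  have key : ∀ s : ℝ, 0 ≤ s → max 0 (1 - s ^ 2) = 1 - (min 1 s) ^ 2 := by
    intro s hs
    rcases le_total s 1 with h | h
    · rw [min_eq_right h, max_eq_right (by nlinarith)]
    · rw [min_eq_left h, max_eq_left (by nlinarith)]; norm_num
  unfold quadBump
  rw [key _ (norm_nonneg a), key _ (norm_nonneg b)]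
  have h1 : |min 1 ‖b‖ - min 1 ‖a‖| ≤ |‖b‖ - ‖a‖| := by
    have := abs_min_sub_min_le_max 1 ‖b‖ 1 ‖a‖
    simpa using this
  have h2 : |‖b‖ - ‖a‖| ≤ ‖a - b‖ := by
    rw [abs_sub_comm]; exact abs_norm_sub_norm_le a b
  have h3 : 0 ≤ min 1 ‖b‖ + min 1 ‖a‖ := by positivity
  have h4 : min 1 ‖b‖ + min 1 ‖a‖ ≤ 2 := by
    linarith [min_le_left 1 ‖b‖, min_le_left 1 ‖a‖]
  calc |1 - min 1 ‖a‖ ^ 2 - (1 - min 1 ‖b‖ ^ 2)|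
      = (min 1 ‖b‖ + min 1 ‖a‖) * |min 1 ‖b‖ - min 1 ‖a‖| := by
        rw [show 1 - min 1 ‖a‖ ^ 2 - (1 - min 1 ‖b‖ ^ 2)
          = (min 1 ‖b‖ + min 1 ‖a‖) * (min 1 ‖b‖ - min 1 ‖a‖) by ring, abs_mul, abs_of_nonneg h3]
    _ ≤ 2 * ‖a - b‖ := by
        apply mul_le_mul h4 (h1.trans h2) (abs_nonneg _) (by norm_num)

lemma integral_quadBump_pos {n : ℕ} : 0 < ∫ y : Euc n, quadBump y := by
  refine continuous_quadBump.integral_pos_of_hasCompactSupport_nonneg_nonzero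
    hasCompactSupport_quadBump quadBump_nonneg (x := 0) ?_
  simp [quadBump]

lemma hasDerivAt_max_zero_sq (s : ℝ) :
    HasDerivAt (fun x : ℝ => (max 0 x) ^ 2) (2 * max 0 s) s := by
  rcases lt_trichotomy s 0 with h | h | h
  · rw [max_eq_left h.le, mul_zero]
    refine (hasDerivAt_const s (0 : ℝ)).congr_of_eventuallyEq ?_
    filter_upwards [gt_mem_nhds h] with x hx
    simp [max_eq_left hx.le]
  · subst h
    rw [hasDerivAt_iff_isLittleO_nhds_zero]
    simp only [zero_add, max_self, mul_zero, smul_zero, sub_zero]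
    have h1 : (fun h : ℝ => max 0 h ^ 2 - 0 ^ 2) =O[𝓝 0] fun h : ℝ => h ^ 2 := by
      refine Asymptotics.IsBigO.of_bound 1 (Eventually.of_forall fun x => ?_)
      rcases le_total x 0 with hx | hx
      · simp [max_eq_left hx]; positivity
      · simp [max_eq_right hx]
    refine h1.trans_isLittleO ?_
    have := Asymptotics.isLittleO_pow_pow (𝕜 := ℝ) (m := 1) (n := 2) (by norm_num)
    simpa using this
  · rw [max_eq_right h.le]
    have := hasDerivAt_pow 2 s
    simp only [Nat.cast_ofNat, Nat.add_one_sub_one, pow_one] at this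
    refine this.congr_of_eventuallyEq ?_
    filter_upwards [lt_mem_nhds h] with x hx
    simp [max_eq_right (le_of_lt hx)]

lemma hasFDerivAt_quadBump_sq {n : ℕ} (y : Euc n) :
    HasFDerivAt (fun z : Euc n => quadBump z ^ 2) ((-4 * quadBump y) • innerSL ℝ y) y := by
  have h1 : HasFDerivAt (fun z : Euc n => 1 - ‖z‖ ^ 2) (-((2 : ℝ) • innerSL ℝ y)) y := by
    refine ((hasStrictFDerivAt_norm_sq y).hasFDerivAt.const_sub 1).congr_fderiv ?_
    ext v; simp
  have h2 := (hasDerivAt_max_zero_sq (1 - ‖y‖ ^ 2)).comp_hasFDerivAt y h1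
  refine h2.congr_fderiv ?_
  ext v
  simp [quadBump]
  ring

/-- Mean value property with respect to the weight `quadBump`, for a globally `C²` function
that is harmonic in a ball. -/
lemma integral_quadBump_mean_value {n : ℕ} {h : Euc n → ℝ} (hh : ContDiff ℝ 2 h) (x : Euc n)
    {r : ℝ} (hr : 0 < r) (hlap : ∀ z ∈ ball x r, lap n h z = 0) :
    ∫ y, h (x + r • y) * quadBump y = h x * ∫ y : Euc n, quadBump y := by
  have hh1 : ContDiff ℝ 1 (fderiv ℝ h) := hh.fderiv_right (by norm_num)
  have hdiff : Differentiable ℝ h := hh.differentiable (by norm_num)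
  have hcs : ∀ g : Euc n → ℝ, Continuous g → Integrable (fun y => g y * quadBump y) :=
    fun g hg => (hg.mul continuous_quadBump).integrable_of_hasCompactSupport
      hasCompactSupport_quadBump.mul_left
  set F : ℝ → ℝ := fun t => ∫ y, h (x + t • y) * quadBump y with hF
  set F' : ℝ → ℝ := fun t => ∫ y, fderiv ℝ h (x + t • y) y * quadBump y with hF'
  have hderiv : ∀ t, HasDerivAt F (F' t) t := by
    intro t
    have hcont : Continuous fun q : ℝ × Euc n => fderiv ℝ h (x + q.1 • q.2) q.2 := by
      have := hh1.continuous
      exact (this.comp (by fun_prop)).clm_apply continuous_snd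
    obtain ⟨M, hM⟩ := ((isCompact_closedBall t 1).prod
      (isCompact_closedBall (0 : Euc n) 1)).exists_bound_of_continuousOn hcont.continuousOn
    refine (hasDerivAt_integral_of_dominated_loc_of_deriv_le (𝕜 := ℝ)
      (F := fun t y => h (x + t • y) * quadBump y)
      (F' := fun t y => fderiv ℝ h (x + t • y) y * quadBump y)
      (bound := fun y => M * quadBump y) (closedBall_mem_nhds t one_pos) ?_ ?_ ?_ ?_ ?_ ?_).2
    · refine Eventually.of_forall fun s => ?_
      exact (hcs (fun y => h (x + s • y)) (hh.continuous.comp (by fun_prop))).aestronglyMeasurable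
    · exact hcs (fun y => h (x + t • y)) (hh.continuous.comp (by fun_prop))
    · exact (hcs (fun y => fderiv ℝ h (x + t • y) y)
        (hcont.comp (Continuous.prodMk_right t))).aestronglyMeasurable
    · refine Eventually.of_forall fun y s hs => ?_
      rw [norm_mul, Real.norm_of_nonneg (quadBump_nonneg y)]
      rcases le_total ‖y‖ 1 with hy | hy
      · exact mul_le_mul_of_nonneg_right (hM (s, y) ⟨hs, by simpa using hy⟩) (quadBump_nonneg y)
      · simp [quadBump_eq_zero hy]
    · exact hcs (fun _ => M) continuous_const
    · refine Eventually.of_forall fun y s _ => ?_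
      have h1 : HasDerivAt (fun t : ℝ => x + t • y) y s := by
        simpa using ((hasDerivAt_id s).smul_const y).const_add x
      exact ((hdiff _).hasFDerivAt.comp_hasDerivAt s h1).mul_const _
  have hzero : ∀ t ∈ Set.Icc 0 r, F' t = 0 := by
    intro t ht
    let e : Fin n → Euc n := fun i => EuclideanSpace.single i 1
    let f : Fin n → Euc n → ℝ := fun i y => fderiv ℝ h (x + t • y) (e i)
    have hD : ∀ i, ContDiff ℝ 1 (fun z => fderiv ℝ h z (e i)) :=
      fun i => hh1.clm_apply contDiff_const
    have hf : ∀ i, ContDiff ℝ 1 (f i) := fun i => (hD i).comp (by fun_prop)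
    have hfd : ∀ i y, fderiv ℝ (f i) y (e i)
        = t * fderiv ℝ (fun z => fderiv ℝ h z (e i)) (x + t • y) (e i) := by
      intro i y
      have h1 : HasFDerivAt (fun y : Euc n => x + t • y) (t • ContinuousLinearMap.id ℝ (Euc n)) y :=
        ((hasFDerivAt_id y).const_smul t).const_add x
      have h2 := (((hD i).differentiable (by norm_num)) (x + t • y)).hasFDerivAt.comp y h1
      have h3 : fderiv ℝ (f i) y = _ := h2.fderiv
      rw [h3]; simp
    have hψ : ∀ y v, fderiv ℝ (fun z : Euc n => quadBump z ^ 2) y v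
        = -4 * quadBump y * inner ℝ y v := by
      intro y v
      rw [(hasFDerivAt_quadBump_sq y).fderiv]; simp
    have hcs2 : ∀ g : Euc n → ℝ, Continuous g → Integrable (fun y => g y * quadBump y ^ 2) := by
      intro g hg
      have := hcs (fun y => g y * quadBump y) (hg.mul continuous_quadBump)
      refine this.congr (Eventually.of_forall fun y => ?_)
      simp only; ring
    have hfc : ∀ i, Continuous (fun y => fderiv ℝ (f i) y (e i)) := fun i =>
      ((hf i).continuous_fderiv (by norm_num)).clm_apply continuous_const
    have hparts : ∀ i, ∫ y, f i y * fderiv ℝ (fun z : Euc n => quadBump z ^ 2) y (e i)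
        = - ∫ y, fderiv ℝ (f i) y (e i) * quadBump y ^ 2 := by
      intro i
      refine integral_mul_fderiv_eq_neg_fderiv_mul_of_integrable (hcs2 _ (hfc i)) ?_
        (hcs2 _ (hf i).continuous) (fun y _ => (hf i).differentiable (by norm_num) y)
        (fun y _ => (hasFDerivAt_quadBump_sq y).differentiableAt)
      have := hcs (fun y => f i y * (-4 * inner ℝ y (e i)))
        ((hf i).continuous.mul (by fun_prop))
      refine this.congr (Eventually.of_forall fun y => ?_)
      simp only [hψ]; ring
    have hsumL : ∀ y, ∑ i, f i y * fderiv ℝ (fun z : Euc n => quadBump z ^ 2) y (e i)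
        = -4 * (fderiv ℝ h (x + t • y) y * quadBump y) := by
      intro y
      have hy : fderiv ℝ h (x + t • y) y = ∑ i, y i * f i y := by
        have h1 : ∑ i, y i • e i = y := by
          simpa [e] using (EuclideanSpace.basisFun (Fin n) ℝ).sum_repr y
        have h2 := congrArg (fderiv ℝ h (x + t • y)) h1.symm
        rw [map_sum] at h2
        simpa [f] using h2
      rw [hy, Finset.sum_mul, Finset.mul_sum]
      refine Finset.sum_congr rfl fun i _ => ?_
      rw [hψ]
      simp only [e, EuclideanSpace.inner_single_right]
      simp
      ring
    have hsumR : ∀ y, ∑ i, fderiv ℝ (f i) y (e i) * quadBump y ^ 2 = 0 := by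
      intro y
      rcases le_or_gt 1 ‖y‖ with hy | hy
      · simp [quadBump_eq_zero hy]
      · rw [← Finset.sum_mul]
        simp_rw [hfd]
        rw [← Finset.mul_sum]
        have : lap n h (x + t • y) = 0 := by
          apply hlap
          rw [mem_ball, dist_eq_norm, add_sub_cancel_left, norm_smul, Real.norm_of_nonneg ht.1]
          calc t * ‖y‖ ≤ r * ‖y‖ := by gcongr; exact ht.2
            _ < r * 1 := by gcongr
            _ = r := mul_one r
        unfold lap at this
        simp only [e]
        rw [this]; simp
    have h1 : ∑ i, ∫ y, f i y * fderiv ℝ (fun z : Euc n => quadBump z ^ 2) y (e i) = 0 := by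
      simp_rw [hparts]
      rw [Finset.sum_neg_distrib, ← integral_finsetSum _ (fun i _ => hcs2 _ (hfc i))]
      simp [hsumR]
    rw [← integral_finsetSum] at h1
    · simp_rw [hsumL] at h1
      rw [integral_const_mul] at h1
      simpa using h1
    · intro i _
      have := hcs (fun y => f i y * (-4 * inner ℝ y (e i)))
        ((hf i).continuous.mul (by fun_prop))
      refine this.congr (Eventually.of_forall fun y => ?_)
      simp only [hψ]; ring
  have hconst := constant_of_has_deriv_right_zero (f := F) (a := 0) (b := r)
    (fun t _ => (hderiv t).continuousAt.continuousWithinAt)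
    (fun t ht => by
      have := (hderiv t).hasDerivWithinAt (s := Set.Ici t)
      rwa [hzero t ⟨ht.1, ht.2.le⟩] at this) r ⟨hr.le, le_rfl⟩
  simp only [hF, zero_smul, add_zero] at hconst
  rw [hconst, integral_const_mul]

lemma lap_congr_of_eventuallyEq {n : ℕ} {f g : Euc n → ℝ} {z : Euc n} (h : f =ᶠ[𝓝 z] g) :
    lap n f z = lap n g z := by
  unfold lap
  refine Finset.sum_congr rfl fun i _ => ?_
  have h1 : (fun y => fderiv ℝ f y (EuclideanSpace.single i 1))
      =ᶠ[𝓝 z] fun y => fderiv ℝ g y (EuclideanSpace.single i 1) := by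
    filter_upwards [h.fderiv (𝕜 := ℝ)] with y hy
    rw [hy]
  rw [h1.fderiv_eq]

/-- Mean value property with respect to the weight `quadBump` for harmonic functions on an open
set. -/
lemma integral_quadBump_mean_value_of_contDiffOn {n : ℕ} {O : Set (Euc n)}
    {h : Euc n → ℝ} (hh : ContDiffOn ℝ 2 h O) (hlap : ∀ z ∈ O, lap n h z = 0) {x : Euc n}
    {r R : ℝ} (hr : 0 < r) (hrR : r < R) (hball : ball x R ⊆ O) :
    ∫ y, h (x + r • y) * quadBump y = h x * ∫ y : Euc n, quadBump y := by
  let χ : ContDiffBump x := ⟨r, (r + R) / 2, hr, by linarith⟩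
  have hone : ∀ z ∈ ball x r, (fun w => χ w * h w) =ᶠ[𝓝 z] h := by
    intro z hz
    filter_upwards [isOpen_ball.mem_nhds hz] with w hw
    rw [χ.one_of_mem_closedBall (ball_subset_closedBall hw), one_mul]
  have hsm : ContDiff ℝ 2 (fun w => χ w * h w) := by
    rw [contDiff_iff_contDiffAt]
    intro w
    by_cases hw : w ∈ ball x R
    · have h1 : ContDiffAt ℝ 2 h w :=
        (hh.mono hball).contDiffAt (isOpen_ball.mem_nhds hw)
      exact χ.contDiffAt.mul h1
    · have h0 : (fun w => χ w * h w) =ᶠ[𝓝 w] fun _ => 0 := by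
        have hmem : (closedBall x ((r + R) / 2))ᶜ ∈ 𝓝 w := by
          refine isClosed_closedBall.isOpen_compl.mem_nhds ?_
          intro h2
          apply hw
          rw [mem_ball]
          rw [mem_closedBall] at h2
          linarith
        filter_upwards [hmem] with v hv
        have : χ v = 0 := by
          apply χ.zero_of_le_dist
          have : (r + R) / 2 < dist v x := by simpa using hv
          exact this.le
        rw [this, zero_mul]
      exact contDiffAt_const.congr_of_eventuallyEq h0
  have key := integral_quadBump_mean_value hsm x hr (fun z hz => by
    rw [lap_congr_of_eventuallyEq (hone z hz)]
    exact hlap z (hball (ball_subset_ball hrR.le hz)))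
  have hx1 : χ x * h x = h x := (hone x (mem_ball_self hr)).self_of_nhds
  simp only [hx1] at key
  rw [← key]
  congr 1
  ext y
  rcases le_or_gt 1 ‖y‖ with hy | hy
  · simp [quadBump_eq_zero hy]
  · congr 1
    refine ((hone (x + r • y) ?_).self_of_nhds).symm
    rw [mem_ball, dist_eq_norm, add_sub_cancel_left, norm_smul, Real.norm_of_nonneg hr.le]
    nlinarith

lemma mean_value_eq_setIntegral {n : ℕ} {O : Set (Euc n)}
    {h : Euc n → ℝ} (hh : ContDiffOn ℝ 2 h O) (hlap : ∀ z ∈ O, lap n h z = 0)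
    {x₀ x : Euc n} {r : ℝ} (hr : 0 < r) (hball : ball x₀ (2 * r) ⊆ O) (hx : x ∈ ball x₀ r) :
    h x * ∫ y : Euc n, quadBump y = (2 / r) ^ n *
      ∫ w in ball x₀ (2 * r), h w * quadBump ((2 / r) • (w - x)) := by
  have hr2 : 0 < r / 2 := by positivity
  have hsub : ball x r ⊆ ball x₀ (2 * r) := by
    apply ball_subset_ball'
    rw [mem_ball] at hx
    linarith
  rw [← integral_quadBump_mean_value_of_contDiffOn hh hlap hr2 (by linarith : r / 2 < r)
    (hsub.trans hball)]
  have h1 : ∫ w in ball x₀ (2 * r), h w * quadBump ((2 / r) • (w - x))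
      = ∫ w, h w * quadBump ((2 / r) • (w - x)) := by
    refine setIntegral_eq_integral_of_forall_compl_eq_zero fun w hw => ?_
    rw [quadBump_eq_zero, mul_zero]
    rw [norm_smul, Real.norm_of_nonneg (by positivity)]
    have : r ≤ ‖w - x‖ := by
      by_contra! h2
      exact hw (hsub (by rwa [mem_ball, dist_eq_norm]))
    rw [div_mul_eq_mul_div, le_div_iff₀ hr]
    linarith
  have h2 : ∫ w, h w * quadBump ((2 / r) • (w - x))
      = ∫ w, h (x + w) * quadBump ((2 / r) • w) := by
    rw [← integral_add_left_eq_self _ x]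
    simp
  have h3 := Measure.integral_comp_smul volume
    (fun w : Euc n => h (x + w) * quadBump ((2 / r) • w)) (r / 2)
  have h4 : ∀ y : Euc n, (2 / r) • (r / 2) • y = y := by
    intro y
    rw [smul_smul, div_mul_div_comm, mul_comm, div_self (by positivity), one_smul]
  simp only [h4] at h3
  rw [h3, h1, h2, finrank_euclideanSpace_fin, abs_of_nonneg (by positivity), smul_eq_mul,
    ← inv_pow, inv_div]

/-- Interior Lipschitz estimate for harmonic functions in terms of the `L¹` norm. -/
lemma exists_harmonic_lipschitz (n : ℕ) : ∃ C : ℝ, 0 ≤ C ∧ ∀ (O : Set (Euc n))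
    (h : Euc n → ℝ), ContDiffOn ℝ 2 h O → (∀ z ∈ O, lap n h z = 0) →
    ∀ (x₀ : Euc n) (r : ℝ), 0 < r → ball x₀ (2 * r) ⊆ O → IntegrableOn h (ball x₀ (2 * r)) →
    ∀ x ∈ ball x₀ r, ∀ x' ∈ ball x₀ r,
      |h x - h x'| ≤ C * (r ^ (n + 1))⁻¹ * (∫ w in ball x₀ (2 * r), |h w|) * ‖x - x'‖ := by
  set m := ∫ y : Euc n, quadBump y with hm
  have hmpos : 0 < m := integral_quadBump_pos
  refine ⟨2 ^ (n + 2) / m, by positivity, ?_⟩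
  intro O h hh hlap x₀ r hr hball hInt x hx x' hx'
  have hi : ∀ x : Euc n, IntegrableOn (fun w => h w * quadBump ((2 / r) • (w - x)))
      (ball x₀ (2 * r)) := by
    intro x
    have hc : Continuous fun w : Euc n => quadBump ((2 / r) • (w - x)) :=
      continuous_quadBump.comp (by fun_prop)
    refine Integrable.mul_bdd (c := 1) hInt hc.aestronglyMeasurable
      (Eventually.of_forall fun w => ?_)
    rw [Real.norm_of_nonneg (quadBump_nonneg _)]
    exact quadBump_le_one _
  have h1 := mean_value_eq_setIntegral hh hlap hr hball hx
  have h2 := mean_value_eq_setIntegral hh hlap hr hball hx'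
  have h3 : (h x - h x') * m = (2 / r) ^ n * ∫ w in ball x₀ (2 * r),
      (h w * quadBump ((2 / r) • (w - x)) - h w * quadBump ((2 / r) • (w - x'))) := by
    rw [integral_sub (hi x) (hi x'), sub_mul, h1, h2]; ring
  have h4 : |∫ w in ball x₀ (2 * r),
      (h w * quadBump ((2 / r) • (w - x)) - h w * quadBump ((2 / r) • (w - x')))|
      ≤ ∫ w in ball x₀ (2 * r), |h w| * (2 * ((2 / r) * ‖x - x'‖)) := by
    rw [← Real.norm_eq_abs]
    refine norm_integral_le_of_norm_le (hInt.abs.mul_const _) (Eventually.of_forall fun w => ?_)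
    rw [← mul_sub, Real.norm_eq_abs, abs_mul]
    gcongr
    refine (abs_quadBump_sub_le _ _).trans ?_
    have hr2 : ‖(2 / r : ℝ)‖ = 2 / r := Real.norm_of_nonneg (by positivity)
    rw [← smul_sub, norm_smul (2 / r : ℝ), hr2, sub_sub_sub_cancel_left, norm_sub_rev]
  rw [integral_mul_const] at h4
  have h5 : |h x - h x'| * m ≤ (2 / r) ^ n *
      ((∫ w in ball x₀ (2 * r), |h w|) * (2 * ((2 / r) * ‖x - x'‖))) := by
    rw [← abs_of_pos hmpos, ← abs_mul, h3, abs_mul, abs_of_nonneg (by positivity : 0 ≤ (2 / r) ^ n)]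
    gcongr
  rw [← le_div_iff₀ hmpos] at h5
  refine h5.trans (le_of_eq ?_)
  rw [div_pow, pow_succ r n, pow_add 2 n 2]
  field_simp

/-- Riesz-type bound: the integral of `|w - y|⁻ˢ` over a ball of radius `r` is `O(rⁿ⁻ˢ)`. -/
lemma exists_integral_norm_rpow_le {n : ℕ} (hn : 1 ≤ n) {s : ℝ} (hs0 : 0 ≤ s) (hs : s < n) :
    ∃ C : ℝ, 0 ≤ C ∧ ∀ (y z : Euc n) (r : ℝ), 0 < r →
      IntegrableOn (fun w => ‖w - y‖ ^ (-s)) (ball z r) ∧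
      ∫ w in ball z r, ‖w - y‖ ^ (-s) ≤ C * r ^ ((n : ℝ) - s) := by
  have hmeas : Measurable fun w : Euc n => ‖w‖ ^ (-s) := by fun_prop
  have hInt0 : ∀ r : ℝ, IntegrableOn (fun w : Euc n => ‖w‖ ^ (-s)) (ball 0 r) := by
    intro r
    refine integrableOn_ball_of_norm_le_rpow (C := 1) (α := s) (by simpa using hn)
      (by simpa using hs) (Eventually.of_forall fun x => ?_) hmeas.aestronglyMeasurable
    rw [Real.norm_of_nonneg (by positivity), one_mul]
  set A := ∫ w in ball (0 : Euc n) 1, ‖w‖ ^ (-s) with hA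
  have hA0 : 0 ≤ A := integral_nonneg fun w => by positivity
  set B := (volume (ball (0 : Euc n) 1)).toReal with hB
  have hpre : ∀ (y : Euc n) r, (fun w => w - y) ⁻¹' ball 0 r = ball y r := by
    intro y r; ext w; simp [dist_eq_norm]
  have hmp : ∀ y : Euc n, MeasurePreserving (fun w => w - y) (volume : Measure (Euc n)) volume :=
    fun y => measurePreserving_sub_right volume y
  have hemb : ∀ y : Euc n, MeasurableEmbedding (fun w => w - y) :=
    fun y => measurableEmbedding_subRight y
  have hInty : ∀ (y : Euc n) r, IntegrableOn (fun w => ‖w - y‖ ^ (-s)) (ball y r) := by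
    intro y r
    have := ((hmp y).integrableOn_comp_preimage (hemb y)).2 (hInt0 r)
    rwa [hpre] at this
  have hvaly : ∀ (y : Euc n) r, 0 < r → ∫ w in ball y r, ‖w - y‖ ^ (-s) = A * r ^ ((n : ℝ) - s) := by
    intro y r hr
    have h1 := (hmp y).setIntegral_preimage_emb (hemb y) (fun w => ‖w‖ ^ (-s)) (ball 0 r)
    rw [hpre] at h1
    rw [h1]
    have h2 := Measure.setIntegral_comp_smul (volume : Measure (Euc n)) (fun w => ‖w‖ ^ (-s))
      (ball 0 1) hr.ne'
    rw [smul_unitBall hr.ne', Real.norm_of_nonneg hr.le, finrank_euclideanSpace_fin,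
      abs_of_nonneg (by positivity), smul_eq_mul] at h2
    have h3 : ∫ w in ball (0 : Euc n) 1, ‖r • w‖ ^ (-s) = r ^ (-s) * A := by
      rw [hA, ← integral_const_mul]
      congr 1; ext w
      rw [norm_smul, Real.norm_of_nonneg hr.le, Real.mul_rpow hr.le (norm_nonneg _)]
    rw [h3] at h2
    have h4 : r ^ ((n : ℝ) - s) = r ^ n * r ^ (-s) := by
      rw [← Real.rpow_natCast, ← Real.rpow_add hr]; rfl
    rw [h4]
    have : (r ^ n) ≠ 0 := by positivity
    field_simp at h2
    linarith
  refine ⟨A + B, by positivity, ?_⟩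
  intro y z r hr
  have hpt : ∀ w, ‖w - y‖ ^ (-s) ≤ (ball y r).indicator (fun w => ‖w - y‖ ^ (-s)) w + r ^ (-s) := by
    intro w
    by_cases hw : w ∈ ball y r
    · rw [Set.indicator_of_mem hw]
      have : 0 ≤ r ^ (-s) := by positivity
      linarith
    · rw [Set.indicator_of_notMem hw, zero_add]
      rw [mem_ball, dist_eq_norm, not_lt] at hw
      exact Real.rpow_le_rpow_of_nonpos hr hw (by linarith)
  have hI1 : Integrable ((ball y r).indicator (fun w => ‖w - y‖ ^ (-s))) :=
    (integrable_indicator_iff measurableSet_ball).2 (hInty y r)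
  have hI2 : IntegrableOn (fun w => (ball y r).indicator (fun w => ‖w - y‖ ^ (-s)) w + r ^ (-s))
      (ball z r) :=
    hI1.integrableOn.add (integrableOn_const measure_ball_lt_top.ne)
  have hI : IntegrableOn (fun w => ‖w - y‖ ^ (-s)) (ball z r) := by
    refine hI2.mono' (Measurable.aestronglyMeasurable (by fun_prop)) (Eventually.of_forall fun w => ?_)
    rw [Real.norm_of_nonneg (by positivity)]
    exact hpt w
  refine ⟨hI, ?_⟩
  calc ∫ w in ball z r, ‖w - y‖ ^ (-s)
      ≤ ∫ w in ball z r, ((ball y r).indicator (fun w => ‖w - y‖ ^ (-s)) w + r ^ (-s)) :=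
        setIntegral_mono hI hI2 hpt
    _ = (∫ w in ball z r, (ball y r).indicator (fun w => ‖w - y‖ ^ (-s)) w)
          + volume.real (ball z r) * r ^ (-s) := by
        rw [integral_add hI1.integrableOn (integrableOn_const measure_ball_lt_top.ne)]
        simp
    _ ≤ A * r ^ ((n : ℝ) - s) + B * r ^ ((n : ℝ) - s) := by
        refine add_le_add ?_ (le_of_eq ?_)
        · rw [← hvaly y r hr, ← integral_indicator (s := ball y r) measurableSet_ball]
          refine setIntegral_le_integral hI1 (Eventually.of_forall fun w => ?_)
          exact Set.indicator_nonneg (fun w _ => by positivity) w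
        · have hv : volume.real (ball z r) = r ^ n * B := by
            rw [Measure.real, Measure.addHaar_ball_of_pos volume z hr, finrank_euclideanSpace_fin,
              ENNReal.toReal_mul, ENNReal.toReal_ofReal (by positivity)]
          have h4 : r ^ ((n : ℝ) - s) = r ^ n * r ^ (-s) := by
            rw [← Real.rpow_natCast, ← Real.rpow_add hr]; rfl
          rw [hv, h4]; ring
    _ = (A + B) * r ^ ((n : ℝ) - s) := by ring

lemma abs_rpow_neg_sub_le {s ρ a b : ℝ} (hs : 0 ≤ s) (hρ : 0 < ρ) (ha : ρ ≤ a) (hb : ρ ≤ b) :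
    |a ^ (-s) - b ^ (-s)| ≤ s * ρ ^ (-s - 1) * |a - b| := by
  have h := Convex.norm_image_sub_le_of_norm_hasDerivWithin_le (𝕜 := ℝ)
    (f := fun x : ℝ => x ^ (-s)) (f' := fun x => -s * x ^ (-s - 1)) (s := Set.Ici ρ)
    (x := b) (y := a) (C := s * ρ ^ (-s - 1)) ?_ ?_ (convex_Ici ρ) hb ha
  · simpa [Real.norm_eq_abs] using h
  · intro x hx
    have hx0 : 0 < x := hρ.trans_le hx
    exact (Real.hasDerivAt_rpow_const (Or.inl hx0.ne')).hasDerivWithinAt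
  · intro x hx
    have hx0 : 0 < x := hρ.trans_le hx
    rw [norm_mul, norm_neg, Real.norm_of_nonneg hs, Real.norm_of_nonneg (by positivity)]
    exact mul_le_mul_of_nonneg_left (Real.rpow_le_rpow_of_nonpos hρ hx (by linarith)) hs

/-- The regularized Riesz kernel `(|z|² + ε)^(-s/2)`. -/
def rieszKer {n : ℕ} (s ε : ℝ) (z : Euc n) : ℝ := (‖z‖ ^ 2 + ε) ^ (-s / 2)

/-- The derivative of the regularized Riesz kernel. -/
def rieszKerDeriv {n : ℕ} (s ε : ℝ) (z : Euc n) : Euc n →L[ℝ] ℝ :=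
  (-s * (‖z‖ ^ 2 + ε) ^ (-s / 2 - 1)) • innerSL ℝ z

lemma rieszKer_zero {n : ℕ} (s : ℝ) (z : Euc n) : rieszKer s 0 z = ‖z‖ ^ (-s) := by
  rw [rieszKer, add_zero, ← Real.rpow_natCast, ← Real.rpow_mul (norm_nonneg z)]
  congr 1; push_cast; ring

lemma rieszKerDeriv_zero {n : ℕ} (s : ℝ) (z : Euc n) :
    rieszKerDeriv s 0 z = (-s * ‖z‖ ^ (-(s + 2))) • innerSL ℝ z := by
  rw [rieszKerDeriv, add_zero, ← Real.rpow_natCast, ← Real.rpow_mul (norm_nonneg z)]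
  congr 3; push_cast; ring

lemma hasFDerivAt_rieszKer {n : ℕ} (s : ℝ) {ε : ℝ} {z : Euc n} (h : 0 < ‖z‖ ^ 2 + ε) :
    HasFDerivAt (rieszKer s ε) (rieszKerDeriv s ε z) z := by
  have h1 : HasFDerivAt (fun z : Euc n => ‖z‖ ^ 2 + ε) ((2 : ℝ) • innerSL ℝ z) z := by
    refine ((hasStrictFDerivAt_norm_sq z).hasFDerivAt.add_const ε).congr_fderiv ?_
    ext v; simp
  refine ((Real.hasDerivAt_rpow_const (p := -s / 2) (Or.inl h.ne')).comp_hasFDerivAt z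
    h1).congr_fderiv ?_
  ext v
  simp [rieszKerDeriv]
  ring

lemma norm_rieszKerDeriv_le {n : ℕ} {s ε : ℝ} (hs : 0 ≤ s) (hε : 0 ≤ ε) (z : Euc n) :
    ‖rieszKerDeriv s ε z‖ ≤ s * ‖z‖ ^ (-(s + 1)) := by
  rw [rieszKerDeriv, norm_smul, innerSL_apply_norm, norm_mul, norm_neg, Real.norm_of_nonneg hs,
    Real.norm_of_nonneg (by positivity), mul_assoc]
  refine mul_le_mul_of_nonneg_left ?_ hs
  rcases eq_or_ne z 0 with rfl | hz
  · simp; positivity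
  · have hz0 : 0 < ‖z‖ := norm_pos_iff.2 hz
    have h1 : (‖z‖ ^ 2 + ε) ^ (-s / 2 - 1) ≤ (‖z‖ ^ 2) ^ (-s / 2 - 1) :=
      Real.rpow_le_rpow_of_nonpos (by positivity) (by linarith) (by linarith)
    have h2 : (‖z‖ ^ 2) ^ (-s / 2 - 1) * ‖z‖ = ‖z‖ ^ (-(s + 1)) := by
      rw [← Real.rpow_natCast, ← Real.rpow_mul (norm_nonneg z)]
      nth_rewrite 2 [← Real.rpow_one ‖z‖]
      rw [← Real.rpow_add hz0]
      congr 1; push_cast; ring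
    rw [← h2]
    gcongr

lemma rieszKer_le {n : ℕ} {s ε : ℝ} (hs : 0 ≤ s) (hε : 0 ≤ ε) {z : Euc n} (hz : z ≠ 0) :
    rieszKer s ε z ≤ ‖z‖ ^ (-s) := by
  have hz0 : 0 < ‖z‖ := norm_pos_iff.2 hz
  rw [← rieszKer_zero, rieszKer, rieszKer, add_zero]
  exact Real.rpow_le_rpow_of_nonpos (by positivity) (by linarith) (by linarith)

lemma rieszKer_nonneg {n : ℕ} {s ε : ℝ} (hε : 0 ≤ ε) (z : Euc n) : 0 ≤ rieszKer s ε z := by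
  unfold rieszKer; positivity

lemma measurable_rieszKer {n : ℕ} (s ε : ℝ) : Measurable (rieszKer (n := n) s ε) := by
  unfold rieszKer; fun_prop

lemma stronglyMeasurable_rieszKerDeriv {n : ℕ} (s ε : ℝ) :
    StronglyMeasurable (rieszKerDeriv (n := n) s ε) := by
  unfold rieszKerDeriv
  have h1 : Measurable fun z : Euc n => -s * (‖z‖ ^ 2 + ε) ^ (-s / 2 - 1) := by fun_prop
  exact h1.stronglyMeasurable.smul (innerSL ℝ).continuous.stronglyMeasurable

lemma tendsto_rieszKer {n : ℕ} (s : ℝ) {z : Euc n} (hz : z ≠ 0) {ε : ℕ → ℝ}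
    (hε : Tendsto ε atTop (𝓝 0)) :
    Tendsto (fun m => rieszKer s (ε m) z) atTop (𝓝 (rieszKer s 0 z)) := by
  have hz0 : 0 < ‖z‖ := norm_pos_iff.2 hz
  have h1 : Tendsto (fun m => ‖z‖ ^ 2 + ε m) atTop (𝓝 (‖z‖ ^ 2 + 0)) := hε.const_add _
  exact h1.rpow_const (Or.inl (by positivity))

lemma tendsto_rieszKerDeriv {n : ℕ} (s : ℝ) {z : Euc n} (hz : z ≠ 0) {ε : ℕ → ℝ}
    (hε : Tendsto ε atTop (𝓝 0)) :
    Tendsto (fun m => rieszKerDeriv s (ε m) z) atTop (𝓝 (rieszKerDeriv s 0 z)) := by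
  have hz0 : 0 < ‖z‖ := norm_pos_iff.2 hz
  have h1 : Tendsto (fun m => ‖z‖ ^ 2 + ε m) atTop (𝓝 (‖z‖ ^ 2 + 0)) := hε.const_add _
  exact ((h1.rpow_const (Or.inl (by positivity))).const_mul _).smul_const _

lemma ae_ne_of_dim {n : ℕ} (hn : 1 ≤ n) (μ : Measure (Euc n)) (hμ : μ ≪ volume) (x : Euc n) :
    ∀ᵐ y ∂μ, y ≠ x := by
  have : Nontrivial (Euc n) :=
    Module.nontrivial_of_finrank_pos (R := ℝ) (by rw [finrank_euclideanSpace_fin]; omega)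
  exact hμ.ae_le (Measure.ae_ne volume x)

lemma integrableOn_norm_sub_rpow {n : ℕ} (hn : 1 ≤ n) {s : ℝ} (hs0 : 0 ≤ s) (hs : s < n)
    {O : Set (Euc n)} (hO : Bornology.IsBounded O) (x : Euc n) :
    IntegrableOn (fun y => ‖x - y‖ ^ (-s)) O := by
  obtain ⟨R, hR⟩ := hO.subset_ball_lt 0 x
  obtain ⟨C, -, hC⟩ := exists_integral_norm_rpow_le hn hs0 hs
  simp_rw [norm_sub_rev x]
  exact ((hC x x R hR.1).1).mono_set hR.2

/-- A Riesz potential of a bounded function on a bounded set is differentiable, and it may be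
differentiated under the integral sign. -/
lemma hasFDerivAt_riesz_potential {n : ℕ} (hn : 1 ≤ n) {s : ℝ} (hs0 : 0 ≤ s) (hs : s + 1 < n)
    {O : Set (Euc n)} (hO : Bornology.IsBounded O) (hOm : MeasurableSet O) {f : Euc n → ℝ}
    (hf : AEStronglyMeasurable f (volume.restrict O)) {M : ℝ} (hM : ∀ y ∈ O, |f y| ≤ M)
    (x₀ : Euc n) :
    HasFDerivAt (fun x => ∫ y in O, ‖x - y‖ ^ (-s) * f y)
      (∫ y in O, f y • rieszKerDeriv s 0 (x₀ - y)) x₀ := by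
  obtain ⟨R, hR0, hR⟩ := hO.subset_ball_lt 0 x₀
  have hfin : IsFiniteMeasure (volume.restrict O) :=
    ⟨by rw [Measure.restrict_apply_univ]; exact hO.measure_lt_top⟩
  have hMae : ∀ᵐ y ∂(volume.restrict O), |f y| ≤ M := by
    filter_upwards [ae_restrict_mem hOm] with y hy using hM y hy
  have hsub : ∀ x, MeasurePreserving (fun y => x - y) (volume : Measure (Euc n)) volume :=
    fun x => Measure.measurePreserving_sub_left volume x
  have hsube : ∀ x : Euc n, MeasurableEmbedding (fun y => x - y) :=
    fun x => (Homeomorph.subLeft x).measurableEmbedding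
  set ε : ℕ → ℝ := fun m => 1 / ((m : ℝ) + 1) with hε
  have hεpos : ∀ m, 0 < ε m := fun m => by positivity
  have hε0 : Tendsto ε atTop (𝓝 0) := tendsto_one_div_add_atTop_nhds_zero_nat
  have hgm : ∀ ε x, AEStronglyMeasurable (fun y => f y • rieszKerDeriv s ε (x - y))
      (volume.restrict O) := fun ε x =>
    hf.smul (((stronglyMeasurable_rieszKerDeriv s ε).comp_measurable
      (by fun_prop : Measurable fun y => x - y)).aestronglyMeasurable)
  have hkm : ∀ ε x, AEStronglyMeasurable (fun y => rieszKer s ε (x - y) * f y)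
      (volume.restrict O) := fun ε x =>
    (((measurable_rieszKer s ε).comp
      (by fun_prop : Measurable fun y => x - y)).aestronglyMeasurable).mul hf
  have hgint : ∀ ε, 0 ≤ ε → ∀ x, Integrable (fun y => f y • rieszKerDeriv s ε (x - y))
      (volume.restrict O) := by
    intro ε hε x
    refine (((integrableOn_norm_sub_rpow hn (by linarith) hs hO x).const_mul (M * s))).mono'
      (hgm ε x) ?_
    filter_upwards [hMae] with y hy
    rw [norm_smul, mul_assoc]
    exact mul_le_mul hy (norm_rieszKerDeriv_le hs0 hε _) (norm_nonneg _) ((abs_nonneg _).trans hy)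
  have hnez : ∀ x : Euc n, ∀ᵐ y ∂(volume.restrict O), x - y ≠ 0 := fun x => by
    filter_upwards [ae_ne_of_dim hn _ Measure.absolutelyContinuous_restrict x] with y hy
    exact sub_ne_zero.2 hy.symm
  set B := ball (0 : Euc n) (R + 1)
  set δ : ℕ → ℝ := fun m => ∫ z in B, ‖rieszKerDeriv s (ε m) z - rieszKerDeriv s 0 z‖ with hδ
  have hBint : IntegrableOn (fun z : Euc n => s * ‖z‖ ^ (-(s + 1)) + s * ‖z‖ ^ (-(s + 1))) B := by
    have h := integrableOn_norm_sub_rpow hn (by linarith) hs (isBounded_ball (x := 0) (r := R + 1))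
      (0 : Euc n)
    simp only [zero_sub, norm_neg] at h
    exact (h.const_mul s).add (h.const_mul s)
  have hdm : ∀ m, AEStronglyMeasurable
      (fun z : Euc n => ‖rieszKerDeriv s (ε m) z - rieszKerDeriv s 0 z‖) (volume.restrict B) :=
    fun m => (((stronglyMeasurable_rieszKerDeriv s (ε m)).sub
      (stronglyMeasurable_rieszKerDeriv s 0)).norm).aestronglyMeasurable
  have hdb : ∀ m (z : Euc n), ‖rieszKerDeriv s (ε m) z - rieszKerDeriv s 0 z‖
      ≤ s * ‖z‖ ^ (-(s + 1)) + s * ‖z‖ ^ (-(s + 1)) := fun m z =>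
    (norm_sub_le _ _).trans
      (add_le_add (norm_rieszKerDeriv_le hs0 (hεpos m).le z) (norm_rieszKerDeriv_le hs0 le_rfl z))
  have hδ0 : Tendsto δ atTop (𝓝 0) := by
    have h := tendsto_integral_of_dominated_convergence (μ := volume.restrict B)
      (F := fun m (z : Euc n) => ‖rieszKerDeriv s (ε m) z - rieszKerDeriv s 0 z‖)
      (f := fun _ => (0 : ℝ)) _ hdm hBint
      (fun m => Eventually.of_forall fun z => by
        rw [norm_norm]; exact hdb m z) ?_
    · simpa using h
    · filter_upwards [ae_ne_of_dim hn _ Measure.absolutelyContinuous_restrict 0] with z hz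
      have := (tendsto_rieszKerDeriv s hz hε0).sub_const (rieszKerDeriv s 0 z)
      simpa using this.norm
  have hunif : ∀ m, ∀ x ∈ ball x₀ 1, ‖(∫ y in O, f y • rieszKerDeriv s 0 (x - y)) -
      ∫ y in O, f y • rieszKerDeriv s (ε m) (x - y)‖ ≤ |M| * δ m := by
    intro m x hx
    have hpre : O ⊆ (fun y => x - y) ⁻¹' B := by
      intro y hy
      have h1 := hR hy
      rw [mem_ball] at h1 hx
      simp only [Set.mem_preimage, B, mem_ball_zero_iff]
      rw [← dist_eq_norm]
      calc dist x y ≤ dist x x₀ + dist y x₀ := dist_triangle_right _ _ _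
        _ < R + 1 := by linarith
    have hBint' : IntegrableOn (fun z => ‖rieszKerDeriv s (ε m) z - rieszKerDeriv s 0 z‖) B :=
      hBint.mono' (hdm m) (Eventually.of_forall fun z => by
        rw [norm_norm]; exact hdb m z)
    have hpi := ((hsub x).integrableOn_comp_preimage (hsube x)).2 hBint'
    rw [← integral_sub (hgint 0 le_rfl x) (hgint _ (hεpos m).le x)]
    calc _ ≤ ∫ y in O, |M| * ‖rieszKerDeriv s (ε m) (x - y) - rieszKerDeriv s 0 (x - y)‖ := by
          refine norm_integral_le_of_norm_le ((hpi.mono_set hpre).const_mul _) ?_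
          filter_upwards [hMae] with y hy
          have h1 : f y • rieszKerDeriv s 0 (x - y) - f y • rieszKerDeriv s (ε m) (x - y)
              = f y • (rieszKerDeriv s 0 (x - y) - rieszKerDeriv s (ε m) (x - y)) :=
            (smul_sub _ _ _).symm
          rw [h1, norm_smul, norm_sub_rev]
          exact mul_le_mul_of_nonneg_right (hy.trans (le_abs_self M)) (norm_nonneg _)
      _ = |M| * ∫ y in O, ‖rieszKerDeriv s (ε m) (x - y) - rieszKerDeriv s 0 (x - y)‖ :=
          integral_const_mul _ _
      _ ≤ |M| * ∫ y in (fun y => x - y) ⁻¹' B,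
            ‖rieszKerDeriv s (ε m) (x - y) - rieszKerDeriv s 0 (x - y)‖ := by
          refine mul_le_mul_of_nonneg_left ?_ (abs_nonneg M)
          exact setIntegral_mono_set hpi (Eventually.of_forall fun y => norm_nonneg _)
            hpre.eventuallyLE
      _ = |M| * δ m := by
          rw [hδ]
          congr 1
          exact (hsub x).setIntegral_preimage_emb (hsube x)
            (fun z => ‖rieszKerDeriv s (ε m) z - rieszKerDeriv s 0 z‖) B
  have hmain := hasFDerivAt_of_tendstoUniformlyOn (l := atTop) (s := ball x₀ 1)
    (f := fun m x => ∫ y in O, rieszKer s (ε m) (x - y) * f y)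
    (f' := fun m x => ∫ y in O, f y • rieszKerDeriv s (ε m) (x - y))
    (g := fun x => ∫ y in O, rieszKer s 0 (x - y) * f y)
    (g' := fun x => ∫ y in O, f y • rieszKerDeriv s 0 (x - y)) (x := x₀)
    isOpen_ball ?_ ?_ ?_ (mem_ball_self one_pos)
  · simpa only [rieszKer_zero] using hmain
  · rw [Metric.tendstoUniformlyOn_iff]
    intro e he
    have h1 : Tendsto (fun m => |M| * δ m) atTop (𝓝 0) := by simpa using hδ0.const_mul |M|
    filter_upwards [h1.eventually (gt_mem_nhds he)] with m hm x hx
    rw [dist_eq_norm]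
    exact (hunif m x hx).trans_lt hm
  · intro m x hx
    refine hasFDerivAt_integral_of_dominated_of_fderiv_le (𝕜 := ℝ) (s := ball x₀ 1)
      (F := fun x y => rieszKer s (ε m) (x - y) * f y)
      (F' := fun x y => f y • rieszKerDeriv s (ε m) (x - y))
      (bound := fun _ => |M| * (s * (ε m) ^ (-s / 2 - 1) * (R + 1)))
      (isOpen_ball.mem_nhds hx) (Eventually.of_forall fun x => hkm _ x) ?_ (hgm _ x) ?_
      (integrable_const _) ?_
    · refine ((integrableOn_norm_sub_rpow hn hs0 (by linarith) hO x).const_mul M).mono'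
        (hkm _ x) ?_
      filter_upwards [hMae, hnez x] with y hy hxy
      rw [norm_mul, Real.norm_of_nonneg (rieszKer_nonneg (hεpos m).le _), mul_comm]
      exact mul_le_mul hy (rieszKer_le hs0 (hεpos m).le hxy) (rieszKer_nonneg (hεpos m).le _)
        ((abs_nonneg _).trans hy)
    · filter_upwards [hMae, ae_restrict_mem hOm] with y hy hyO x hx
      rw [norm_smul]
      refine mul_le_mul (hy.trans (le_abs_self M)) ?_ (norm_nonneg _) (abs_nonneg M)
      rw [rieszKerDeriv, norm_smul, innerSL_apply_norm, norm_mul, norm_neg,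
        Real.norm_of_nonneg hs0, Real.norm_of_nonneg (by have := hεpos m; positivity)]
      have h1 : (‖x - y‖ ^ 2 + ε m) ^ (-s / 2 - 1) ≤ ε m ^ (-s / 2 - 1) :=
        Real.rpow_le_rpow_of_nonpos (hεpos m) (by nlinarith [sq_nonneg ‖x - y‖]) (by linarith)
      have h2 : ‖x - y‖ ≤ R + 1 := by
        rw [← dist_eq_norm]
        have h3 := hR hyO
        rw [mem_ball] at h3 hx
        linarith [dist_triangle_right x y x₀]
      have := hεpos m
      gcongr
    · refine Eventually.of_forall fun y x _ => ?_
      have h1 : HasFDerivAt (fun x => x - y) (ContinuousLinearMap.id ℝ (Euc n)) x :=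
        (hasFDerivAt_id x).sub_const y
      have h2 := (hasFDerivAt_rieszKer s (ε := ε m) (z := x - y)
        (by have := hεpos m; positivity)).comp x h1
      rw [ContinuousLinearMap.comp_id] at h2
      exact h2.mul_const (f y)
  · intro x _
    refine tendsto_integral_of_dominated_convergence (fun y => M * ‖x - y‖ ^ (-s))
      (fun m => hkm _ x) ((integrableOn_norm_sub_rpow hn hs0 (by linarith) hO x).const_mul M)
      (fun m => ?_) ?_
    · filter_upwards [hMae, hnez x] with y hy hxy
      rw [norm_mul, Real.norm_of_nonneg (rieszKer_nonneg (hεpos m).le _), mul_comm]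
      exact mul_le_mul hy (rieszKer_le hs0 (hεpos m).le hxy) (rieszKer_nonneg (hεpos m).le _)
        ((abs_nonneg _).trans hy)
    · filter_upwards [hnez x] with y hxy
      exact (tendsto_rieszKer s hxy hε0).mul_const _

lemma lap_sub {n : ℕ} {O : Set (Euc n)} (hO : IsOpen O) {f g : Euc n → ℝ}
    (hf : ContDiffOn ℝ 2 f O) (hg : ContDiffOn ℝ 2 g O) {z : Euc n} (hz : z ∈ O) :
    lap n (fun w => f w - g w) z = lap n f z - lap n g z := by
  have hd : ∀ {f : Euc n → ℝ}, ContDiffOn ℝ 2 f O → ∀ w ∈ O, DifferentiableAt ℝ f w :=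
    fun h w hw => (h.contDiffAt (hO.mem_nhds hw)).differentiableAt (by norm_num)
  have hd2 : ∀ {f : Euc n → ℝ}, ContDiffOn ℝ 2 f O → ∀ v : Euc n,
      DifferentiableAt ℝ (fun y => fderiv ℝ f y v) z := fun h v =>
    (((h.contDiffAt (hO.mem_nhds hz)).fderiv_right (m := 1) (by norm_num)).differentiableAt
      (by norm_num)).clm_apply (differentiableAt_const v)
  unfold lap
  rw [← Finset.sum_sub_distrib]
  refine Finset.sum_congr rfl fun i _ => ?_
  have h1 : (fun y => fderiv ℝ (fun w => f w - g w) y (EuclideanSpace.single i 1)) =ᶠ[𝓝 z]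
      fun y => fderiv ℝ f y (EuclideanSpace.single i 1)
        - fderiv ℝ g y (EuclideanSpace.single i 1) := by
    filter_upwards [hO.mem_nhds hz] with w hw
    rw [fderiv_fun_sub (hd hf w hw) (hd hg w hw)]
    rfl
  rw [h1.fderiv_eq, fderiv_fun_sub (hd2 hf _) (hd2 hg _)]
  rfl

lemma aestronglyMeasurable_clm {n : ℕ} {α : Type*} [MeasurableSpace α] {μ : Measure α}
    {L : α → Euc n →L[ℝ] ℝ} (h : ∀ v, AEStronglyMeasurable (fun a => L a v) μ) :
    AEStronglyMeasurable L μ := by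
  have h1 : L = fun a => ∑ i : Fin n, L a (EuclideanSpace.single i 1) •
      innerSL ℝ (EuclideanSpace.single i (1 : ℝ) : Euc n) := by
    ext a v
    have h2 : ∑ i, v i • (EuclideanSpace.single i (1 : ℝ) : Euc n) = v := by
      simpa using (EuclideanSpace.basisFun (Fin n) ℝ).sum_repr v
    have h3 := congrArg (L a) h2.symm
    rw [map_sum] at h3
    rw [h3, sum_apply]
    refine Finset.sum_congr rfl fun i _ => ?_
    simp [EuclideanSpace.inner_single_left, mul_comm]
  rw [h1]
  exact Finset.aestronglyMeasurable_fun_sum _ fun i _ => (h _).smul_const _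

lemma aestronglyMeasurable_fderiv_param {n : ℕ} {α : Type*} [MeasurableSpace α] {μ : Measure α}
    {F : Euc n → α → ℝ} {L : α → Euc n →L[ℝ] ℝ} {x : Euc n}
    (hF : ∀ᶠ z in 𝓝 x, AEStronglyMeasurable (F z) μ)
    (hL : ∀ᵐ a ∂μ, HasFDerivAt (fun z => F z a) (L a) x) : AEStronglyMeasurable L μ := by
  refine aestronglyMeasurable_clm fun v => ?_
  set t : ℕ → ℝ := fun m => 1 / ((m : ℝ) + 1) with ht
  have ht0 : Tendsto t atTop (𝓝 0) := tendsto_one_div_add_atTop_nhds_zero_nat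
  have htx : Tendsto (fun m => x + t m • v) atTop (𝓝 x) := by
    simpa using (ht0.smul_const v).const_add x
  obtain ⟨N, hN⟩ := eventually_atTop.1 (htx.eventually hF)
  have hx := hF.self_of_nhds
  refine aestronglyMeasurable_of_tendsto_ae atTop
    (f := fun m a => (t (m + N))⁻¹ • (F (x + t (m + N) • v) a - F x a)) (fun m => ?_) ?_
  · exact AEStronglyMeasurable.const_smul ((hN (m + N) (by omega)).sub hx) (t (m + N))⁻¹
  · filter_upwards [hL] with a ha
    have h1 := (ha.hasLineDerivAt v).tendsto_slope_zero
    have h2 : Tendsto (fun m => t (m + N)) atTop (𝓝[≠] 0) := by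
      refine tendsto_nhdsWithin_iff.2 ⟨ht0.comp (tendsto_add_atTop_nat N), ?_⟩
      exact Eventually.of_forall fun m => by
        simp only [ht, Set.mem_compl_iff, Set.mem_singleton_iff]; positivity
    have h3 := h1.comp h2
    simpa [Function.comp_def] using h3

lemma cGreen_nonneg {n : ℕ} (hn : 3 ≤ n) : 0 ≤ cGreen n := by
  have : (3 : ℝ) ≤ n := by exact_mod_cast hn
  have h1 : (0 : ℝ) ≤ (n : ℝ) - 2 := by linarith
  have h2 : 0 ≤ omegaSph n := ENNReal.toReal_nonneg
  unfold cGreen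
  positivity

namespace BlowupSetup

variable {n : ℕ} (S : BlowupSetup n)

lemma H_symm {x y : Euc n} (hx : x ∈ S.Ω) (hy : y ∈ S.Ω) (hxy : x ≠ y) : S.H x y = S.H y x := by
  have h1 := S.Gdecomp x hx y hy hxy
  have h2 := S.Gdecomp y hy x hx hxy.symm
  rw [S.Gsymm, h2, norm_sub_rev] at h1
  linarith

lemma abs_H_le {x y : Euc n} (hx : x ∈ S.Ω) (hy : y ∈ S.Ω) (hxy : x ≠ y) :
    |S.H x y| ≤ cGreen n * ‖x - y‖ ^ (-((n : ℝ) - 2)) := by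
  have h1 := S.Gdecomp x hx y hy hxy
  have h2 := S.Gpos x hx y hy hxy
  have h3 := S.Gle x hx y hy hxy
  rw [neg_sub]
  rw [abs_of_nonneg] <;> linarith

lemma integrableOn_H (hn : 3 ≤ n) {y : Euc n} (hy : y ∈ S.Ω) {A : Set (Euc n)}
    (hA : MeasurableSet A) (hAΩ : A ⊆ S.Ω) : IntegrableOn (fun w => S.H w y) A := by
  have hn' : (3 : ℝ) ≤ n := by exact_mod_cast hn
  have h1 := (integrableOn_norm_sub_rpow (n := n) (by omega) (s := (n : ℝ) - 2) (by linarith)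
    (by linarith) (S.hΩb.subset hAΩ) y).const_mul (cGreen n)
  refine h1.mono' (((S.Hharm y hy).1.continuousOn.mono hAΩ).aestronglyMeasurable hA) ?_
  filter_upwards [ae_restrict_mem hA,
    ae_ne_of_dim (by omega) _ Measure.absolutelyContinuous_restrict y] with w hw hwy
  rw [norm_sub_rev]
  exact S.abs_H_le (hAΩ hw) hy hwy

/-- Interior Lipschitz bound for the regular part of the Green kernel. -/
lemma exists_H_lipschitz (hn : 3 ≤ n) : ∃ C : ℝ, 0 ≤ C ∧ ∀ (x₀ : Euc n) (r : ℝ), 0 < r →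
    ball x₀ (2 * r) ⊆ S.Ω → ∀ y ∈ S.Ω, ∀ x ∈ ball x₀ r, ∀ x' ∈ ball x₀ r,
    |S.H x y - S.H x' y| ≤ C * r ^ (-((n : ℝ) - 1)) * ‖x - x'‖ := by
  have hn' : (3 : ℝ) ≤ n := by exact_mod_cast hn
  obtain ⟨C₁, hC₁, h₁⟩ := exists_harmonic_lipschitz n
  obtain ⟨C₂, hC₂, h₂⟩ := exists_integral_norm_rpow_le (n := n) (by omega) (s := (n : ℝ) - 2)
    (by linarith) (by linarith)
  have hc := cGreen_nonneg hn
  refine ⟨C₁ * (cGreen n * (C₂ * 2 ^ (2 : ℝ))), by positivity, ?_⟩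
  intro x₀ r hr hball y hy x hx x' hx'
  have hInt := S.integrableOn_H hn hy measurableSet_ball hball
  have h3 := h₁ S.Ω (fun w => S.H w y) (S.Hharm y hy).1 (S.Hharm y hy).2 x₀ r hr hball hInt
    x hx x' hx'
  refine h3.trans (mul_le_mul_of_nonneg_right ?_ (norm_nonneg _))
  obtain ⟨h4, h5⟩ := h₂ y x₀ (2 * r) (by positivity)
  have h6 : ∫ w in ball x₀ (2 * r), |S.H w y| ≤ cGreen n * (C₂ * (2 * r) ^ (2 : ℝ)) := by
    rw [show (n : ℝ) - (n - 2) = 2 by ring] at h5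
    calc _ ≤ ∫ w in ball x₀ (2 * r), cGreen n * ‖w - y‖ ^ (-((n : ℝ) - 2)) := by
          refine setIntegral_mono_ae_restrict hInt.abs (h4.const_mul _) ?_
          filter_upwards [ae_restrict_mem measurableSet_ball,
            ae_ne_of_dim (by omega) _ Measure.absolutelyContinuous_restrict y] with w hw hwy
          exact S.abs_H_le (hball hw) hy hwy
      _ = cGreen n * ∫ w in ball x₀ (2 * r), ‖w - y‖ ^ (-((n : ℝ) - 2)) := integral_const_mul _ _
      _ ≤ _ := by gcongr
  have h7 : (r ^ (n + 1))⁻¹ * r ^ (2 : ℝ) = r ^ (-((n : ℝ) - 1)) := by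
    rw [← Real.rpow_natCast, ← Real.rpow_neg hr.le, ← Real.rpow_add hr]
    congr 1; push_cast; ring
  calc C₁ * (r ^ (n + 1))⁻¹ * ∫ w in ball x₀ (2 * r), |S.H w y|
      ≤ C₁ * (r ^ (n + 1))⁻¹ * (cGreen n * (C₂ * (2 * r) ^ (2 : ℝ))) := by gcongr
    _ = C₁ * (cGreen n * (C₂ * 2 ^ (2 : ℝ))) * ((r ^ (n + 1))⁻¹ * r ^ (2 : ℝ)) := by
        rw [Real.mul_rpow (by norm_num) hr.le]; ring
    _ = _ := by rw [h7]

/-- Interior bound for the mixed second differences of the regular part of the Green kernel. -/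
lemma exists_H_lipschitz_mixed (hn : 3 ≤ n) : ∃ C : ℝ, 0 ≤ C ∧ ∀ (x₀ z₀ : Euc n) (r : ℝ), 0 < r →
    ball x₀ (2 * r) ⊆ S.Ω → ball z₀ (2 * r) ⊆ S.Ω →
    ∀ y ∈ ball z₀ r, ∀ y' ∈ ball z₀ r, ∀ x ∈ ball x₀ r, ∀ x' ∈ ball x₀ r,
    |(S.H x y - S.H x y') - (S.H x' y - S.H x' y')|
      ≤ C * r ^ (-(n : ℝ)) * ‖y - y'‖ * ‖x - x'‖ := by
  obtain ⟨C₁, hC₁, h₁⟩ := exists_harmonic_lipschitz n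
  obtain ⟨C₂, hC₂, h₂⟩ := S.exists_H_lipschitz hn
  set B := volume.real (ball (0 : Euc n) 1) with hB
  refine ⟨C₁ * (C₂ * (2 ^ n * B)), by positivity, ?_⟩
  intro x₀ z₀ r hr hbx hbz y hy y' hy' x hx x' hx'
  have hsub : ball z₀ r ⊆ S.Ω := (ball_subset_ball (by linarith)).trans hbz
  have hyO := hsub hy
  have hyO' := hsub hy'
  have hi1 := S.integrableOn_H hn hyO measurableSet_ball hbx
  have hi2 := S.integrableOn_H hn hyO' measurableSet_ball hbx
  have h3 := h₁ S.Ω (fun w => S.H w y - S.H w y')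
    ((S.Hharm y hyO).1.sub (S.Hharm y' hyO').1)
    (fun z hz => by
      rw [lap_sub S.hΩo (S.Hharm y hyO).1 (S.Hharm y' hyO').1 hz, (S.Hharm y hyO).2 z hz,
        (S.Hharm y' hyO').2 z hz, sub_zero])
    x₀ r hr hbx (hi1.sub hi2) x hx x' hx'
  refine h3.trans (mul_le_mul_of_nonneg_right ?_ (norm_nonneg _))
  have h6 : ∫ w in ball x₀ (2 * r), |S.H w y - S.H w y'| ≤
      (2 * r) ^ n * B * (C₂ * r ^ (-((n : ℝ) - 1)) * ‖y - y'‖) := by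
    calc _ ≤ ∫ w in ball x₀ (2 * r), C₂ * r ^ (-((n : ℝ) - 1)) * ‖y - y'‖ := by
          refine setIntegral_mono_ae_restrict (hi1.sub hi2).abs
            (integrableOn_const measure_ball_lt_top.ne) ?_
          filter_upwards [ae_restrict_mem measurableSet_ball,
            ae_ne_of_dim (by omega) _ Measure.absolutelyContinuous_restrict y,
            ae_ne_of_dim (by omega) _ Measure.absolutelyContinuous_restrict y'] with w hw hwy hwy'
          rw [S.H_symm (hbx hw) hyO hwy, S.H_symm (hbx hw) hyO' hwy']
          exact h₂ z₀ r hr hbz w (hbx hw) y hy y' hy'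
      _ = _ := by
          have hv : volume.real (ball x₀ (2 * r)) = (2 * r) ^ n * B := by
            rw [hB, Measure.real, Measure.real, Measure.addHaar_ball_of_pos volume x₀
              (by positivity), finrank_euclideanSpace_fin,
              ENNReal.toReal_mul, ENNReal.toReal_ofReal (by positivity)]
          rw [setIntegral_const, hv, smul_eq_mul]
  have h7 : (r ^ (n + 1))⁻¹ * r ^ n * r ^ (-((n : ℝ) - 1)) = r ^ (-(n : ℝ)) := by
    rw [← Real.rpow_natCast, ← Real.rpow_natCast, ← Real.rpow_neg hr.le, ← Real.rpow_add hr,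
      ← Real.rpow_add hr]
    congr 1; push_cast; ring
  calc C₁ * (r ^ (n + 1))⁻¹ * ∫ w in ball x₀ (2 * r), |S.H w y - S.H w y'|
      ≤ C₁ * (r ^ (n + 1))⁻¹ * ((2 * r) ^ n * B * (C₂ * r ^ (-((n : ℝ) - 1)) * ‖y - y'‖)) := by
        gcongr
    _ = C₁ * (C₂ * (2 ^ n * B)) * ((r ^ (n + 1))⁻¹ * r ^ n * r ^ (-((n : ℝ) - 1))) * ‖y - y'‖ := by
        rw [mul_pow]; ring
    _ = _ := by rw [h7]

lemma hasFDerivAt_H {x y : Euc n} (hx : x ∈ S.Ω) (hy : y ∈ S.Ω) :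
    HasFDerivAt (fun z => S.H z y) (fderiv ℝ (fun z => S.H z y) x) x :=
  (((S.Hharm y hy).1.contDiffAt (S.hΩo.mem_nhds hx)).differentiableAt (by norm_num)).hasFDerivAt

lemma exists_fderiv_H_bound (hn : 3 ≤ n) : ∃ C : ℝ, 0 ≤ C ∧ ∀ (x : Euc n) (r : ℝ), 0 < r →
    ball x (2 * r) ⊆ S.Ω → ∀ y ∈ S.Ω, ∀ x' ∈ ball x r,
    ‖fderiv ℝ (fun z => S.H z y) x'‖ ≤ C * r ^ (-((n : ℝ) - 1)) := by
  obtain ⟨C, hC, h⟩ := S.exists_H_lipschitz hn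
  refine ⟨C, hC, fun x r hr hball y hy x' hx' => ?_⟩
  have hxO : x' ∈ S.Ω := hball (ball_subset_ball (by linarith) hx')
  refine (S.hasFDerivAt_H hxO hy).le_of_lip' (by positivity) ?_
  filter_upwards [isOpen_ball.mem_nhds hx'] with z hz
  exact h x r hr hball y hy z hz x' hx'

lemma exists_fderiv_H_sub_bound (hn : 3 ≤ n) : ∃ C : ℝ, 0 ≤ C ∧ ∀ (x z₀ : Euc n) (r : ℝ), 0 < r →
    ball x (2 * r) ⊆ S.Ω → ball z₀ (2 * r) ⊆ S.Ω → ∀ y ∈ ball z₀ r, ∀ y' ∈ ball z₀ r,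
    ‖fderiv ℝ (fun z => S.H z y) x - fderiv ℝ (fun z => S.H z y') x‖
      ≤ C * r ^ (-(n : ℝ)) * ‖y - y'‖ := by
  obtain ⟨C, hC, h⟩ := S.exists_H_lipschitz_mixed hn
  refine ⟨C, hC, fun x z₀ r hr hbx hbz y hy y' hy' => ?_⟩
  have hxO : x ∈ S.Ω := hbx (mem_ball_self (by positivity))
  have hsub : ball z₀ r ⊆ S.Ω := (ball_subset_ball (by linarith)).trans hbz
  refine ((S.hasFDerivAt_H hxO (hsub hy)).sub (S.hasFDerivAt_H hxO (hsub hy'))).le_of_lip'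
    (by positivity) ?_
  filter_upwards [isOpen_ball.mem_nhds (mem_ball_self hr)] with z hz
  exact h x z₀ r hr hbx hbz y hy y' hy' z hz x (mem_ball_self hr)

/-- The derivative of the Green kernel in its first variable. -/
def Gderiv (x y : Euc n) : Euc n →L[ℝ] ℝ :=
  cGreen n • rieszKerDeriv ((n : ℝ) - 2) 0 (x - y) - fderiv ℝ (fun z => S.H z y) x

lemma hasFDerivAt_G {x y : Euc n} (hx : x ∈ S.Ω) (hy : y ∈ S.Ω) (hxy : x ≠ y) :
    HasFDerivAt (fun z => S.G z y) (S.Gderiv x y) x := by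
  have h0 : 0 < ‖x - y‖ ^ 2 + 0 := by
    have := norm_pos_iff.2 (sub_ne_zero.2 hxy)
    positivity
  have h1 := (hasFDerivAt_rieszKer ((n : ℝ) - 2) h0).comp x ((hasFDerivAt_id x).sub_const y)
  rw [ContinuousLinearMap.comp_id] at h1
  refine ((h1.const_mul (cGreen n)).sub (S.hasFDerivAt_H hx hy)).congr_of_eventuallyEq ?_
  filter_upwards [S.hΩo.mem_nhds hx, isOpen_ne.mem_nhds hxy] with z hz hzy
  rw [S.Gdecomp z hz y hy hzy]
  simp only [Pi.sub_apply, Function.comp_apply, id_eq, rieszKer_zero, neg_sub]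

lemma aestronglyMeasurable_H (hn : 3 ≤ n) {x : Euc n} (hx : x ∈ S.Ω) :
    AEStronglyMeasurable (fun y => S.H x y) (volume.restrict S.Ω) := by
  refine ((S.Hharm x hx).1.continuousOn.aestronglyMeasurable S.hΩo.measurableSet).congr ?_
  filter_upwards [ae_restrict_mem S.hΩo.measurableSet,
    ae_ne_of_dim (by omega) _ Measure.absolutelyContinuous_restrict x] with y hy hyx
  exact S.H_symm hy hx hyx

lemma integrableOn_H_right (hn : 3 ≤ n) {x : Euc n} (hx : x ∈ S.Ω) :
    IntegrableOn (fun y => S.H x y) S.Ω := by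
  refine (S.integrableOn_H hn hx S.hΩo.measurableSet subset_rfl).congr ?_
  filter_upwards [ae_restrict_mem S.hΩo.measurableSet,
    ae_ne_of_dim (by omega) _ Measure.absolutelyContinuous_restrict x] with y hy hyx
  exact S.H_symm hy hx hyx

lemma exists_ball_subset {x : Euc n} (hx : x ∈ S.Ω) : ∃ r > 0, ball x (2 * r) ⊆ S.Ω := by
  obtain ⟨r, hr, h⟩ := Metric.isOpen_iff.1 S.hΩo x hx
  exact ⟨r / 2, by positivity, by rwa [mul_div_cancel₀ r two_ne_zero]⟩

lemma aestronglyMeasurable_fderiv_H (hn : 3 ≤ n) {x : Euc n} (hx : x ∈ S.Ω) :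
    AEStronglyMeasurable (fun y => fderiv ℝ (fun z => S.H z y) x) (volume.restrict S.Ω) := by
  refine aestronglyMeasurable_fderiv_param (F := S.H) (x := x) ?_ ?_
  · filter_upwards [S.hΩo.mem_nhds hx] with z hz using S.aestronglyMeasurable_H hn hz
  · filter_upwards [ae_restrict_mem S.hΩo.measurableSet] with y hy using S.hasFDerivAt_H hx hy

/-- The Green potential of a bounded function is differentiable in `Ω`. -/
lemma hasFDerivAt_potential (hn : 3 ≤ n) {f : Euc n → ℝ}
    (hf : AEStronglyMeasurable f (volume.restrict S.Ω)) {M : ℝ} (hM : ∀ y ∈ S.Ω, |f y| ≤ M)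
    {x : Euc n} (hx : x ∈ S.Ω) :
    HasFDerivAt (fun x => ∫ y in S.Ω, S.G x y * f y) (∫ y in S.Ω, f y • S.Gderiv x y) x ∧
    Integrable (fun y => f y • S.Gderiv x y) (volume.restrict S.Ω) := by
  have hn' : (3 : ℝ) ≤ n := by exact_mod_cast hn
  have hfin : IsFiniteMeasure (volume.restrict S.Ω) :=
    ⟨by rw [Measure.restrict_apply_univ]; exact S.hΩb.measure_lt_top⟩
  have hΩm := S.hΩo.measurableSet
  have hMae : ∀ᵐ y ∂(volume.restrict S.Ω), ‖f y‖ ≤ M := by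
    filter_upwards [ae_restrict_mem hΩm] with y hy using hM y hy
  have hne : ∀ x : Euc n, ∀ᵐ y ∂(volume.restrict S.Ω), y ≠ x :=
    fun x => ae_ne_of_dim (by omega) _ Measure.absolutelyContinuous_restrict x
  have hR := hasFDerivAt_riesz_potential (n := n) (by omega) (s := (n : ℝ) - 2) (by linarith)
    (by linarith) S.hΩb hΩm hf hM x
  obtain ⟨r, hr, hball⟩ := S.exists_ball_subset hx
  obtain ⟨C, hC, hCb⟩ := S.exists_fderiv_H_bound hn
  have hHf : ∀ x ∈ S.Ω, Integrable (fun y => S.H x y * f y) (volume.restrict S.Ω) := fun x hx =>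
    (S.integrableOn_H_right hn hx).mul_bdd hf hMae
  have hKf : ∀ x, Integrable (fun y => ‖x - y‖ ^ (-((n : ℝ) - 2)) * f y) (volume.restrict S.Ω) :=
    fun x => (integrableOn_norm_sub_rpow (n := n) (by omega) (s := (n : ℝ) - 2) (by linarith)
      (by linarith) S.hΩb x).mul_bdd hf hMae
  have hH'm : AEStronglyMeasurable (fun y => f y • fderiv ℝ (fun z => S.H z y) x)
      (volume.restrict S.Ω) := hf.smul (S.aestronglyMeasurable_fderiv_H hn hx)
  have hH'b : ∀ x' ∈ ball x r, ∀ᵐ y ∂(volume.restrict S.Ω),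
      ‖f y • fderiv ℝ (fun z => S.H z y) x'‖ ≤ |M| * (C * r ^ (-((n : ℝ) - 1))) := by
    intro x' hx'
    filter_upwards [ae_restrict_mem hΩm] with y hy
    rw [norm_smul]
    exact mul_le_mul ((hM y hy).trans (le_abs_self M)) (hCb x r hr hball y hy x' hx')
      (norm_nonneg _) (abs_nonneg M)
  have hH' : Integrable (fun y => f y • fderiv ℝ (fun z => S.H z y) x) (volume.restrict S.Ω) :=
    (integrable_const _).mono' hH'm (hH'b x (mem_ball_self hr))
  have hK' : Integrable (fun y => f y • rieszKerDeriv ((n : ℝ) - 2) 0 (x - y))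
      (volume.restrict S.Ω) := by
    have h1 : IntegrableOn (fun y => ((n : ℝ) - 2) * ‖x - y‖ ^ (-((n : ℝ) - 2 + 1))) S.Ω :=
      (integrableOn_norm_sub_rpow (n := n) (by omega) (by linarith) (by linarith)
        S.hΩb x).const_mul _
    refine (h1.const_mul M).mono' (hf.smul (((stronglyMeasurable_rieszKerDeriv _ _).comp_measurable
      (by fun_prop : Measurable fun y => x - y)).aestronglyMeasurable)) ?_
    filter_upwards [hMae] with y hy
    rw [norm_smul]
    exact mul_le_mul hy (norm_rieszKerDeriv_le (by linarith) le_rfl _) (norm_nonneg _)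
      ((norm_nonneg _).trans hy)
  have hHd : HasFDerivAt (fun x => ∫ y in S.Ω, S.H x y * f y)
      (∫ y in S.Ω, f y • fderiv ℝ (fun z => S.H z y) x) x := by
    refine hasFDerivAt_integral_of_dominated_of_fderiv_le (𝕜 := ℝ) (s := ball x r)
      (F := fun x y => S.H x y * f y)
      (F' := fun x y => f y • fderiv ℝ (fun z => S.H z y) x)
      (bound := fun _ => |M| * (C * r ^ (-((n : ℝ) - 1))))
      (isOpen_ball.mem_nhds (mem_ball_self hr)) ?_ (hHf x hx) hH'm ?_ (integrable_const _) ?_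
    · filter_upwards [S.hΩo.mem_nhds hx] with z hz using (hHf z hz).aestronglyMeasurable
    · filter_upwards [ae_restrict_mem hΩm] with y hy x' hx'
      rw [norm_smul]
      exact mul_le_mul ((hM y hy).trans (le_abs_self M)) (hCb x r hr hball y hy x' hx')
        (norm_nonneg _) (abs_nonneg M)
    · filter_upwards [ae_restrict_mem hΩm] with y hy x' hx'
      exact (S.hasFDerivAt_H (hball (ball_subset_ball (by linarith) hx')) hy).mul_const (f y)
  have hsplit : ∀ y, f y • S.Gderiv x y = cGreen n • (f y • rieszKerDeriv ((n : ℝ) - 2) 0 (x - y))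
      - f y • fderiv ℝ (fun z => S.H z y) x := by
    intro y
    ext v
    simp [Gderiv]
    ring
  constructor
  · have h1 : (∫ y in S.Ω, f y • S.Gderiv x y)
        = cGreen n • (∫ y in S.Ω, f y • rieszKerDeriv ((n : ℝ) - 2) 0 (x - y))
          - ∫ y in S.Ω, f y • fderiv ℝ (fun z => S.H z y) x := by
      simp_rw [hsplit]
      rw [integral_sub _ hH', integral_smul]
      exact hK'.smul (cGreen n)
    rw [h1]
    refine ((hR.const_mul (cGreen n)).sub hHd).congr_of_eventuallyEq ?_
    filter_upwards [S.hΩo.mem_nhds hx] with z hz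
    simp only [Pi.sub_apply]
    rw [← integral_const_mul, ← integral_sub ((hKf z).const_mul _) (hHf z hz)]
    refine integral_congr_ae ?_
    filter_upwards [ae_restrict_mem hΩm, hne z] with y hy hyz
    rw [S.Gdecomp z hz y hy hyz.symm, neg_sub]
    ring
  · simp_rw [hsplit]
    exact (hK'.smul (cGreen n)).sub hH'

end BlowupSetup

namespace BlowupSetup

variable {n : ℕ} (S : BlowupSetup n)

lemma omega_ne_univ (hn : 3 ≤ n) : S.Ω ≠ Set.univ := by
  have : Nonempty (Fin n) := ⟨⟨0, by omega⟩⟩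
  intro h
  exact NormedSpace.unbounded_univ ℝ (Euc n) (h ▸ S.hΩb)

lemma d_pos (hn : 3 ≤ n) (k : ℕ) : 0 < S.d k := by
  have hne : (frontier S.Ω).Nonempty :=
    nonempty_frontier_iff.2 ⟨⟨_, S.hxk k⟩, S.omega_ne_univ hn⟩
  have h : S.xk k ∉ frontier S.Ω := fun h => by
    rw [S.hΩo.frontier_eq] at h
    exact h.2 (S.hxk k)
  have := (isClosed_frontier.notMem_iff_infDist_pos hne).1 h
  unfold d
  positivity

lemma ball_xk_subset (hn : 3 ≤ n) (k : ℕ) : ball (S.xk k) (4 * S.d k) ⊆ S.Ω := by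
  obtain ⟨y, hy, hyd⟩ := exists_mem_frontier_infDist_compl_eq_dist (S.hxk k) (S.omega_ne_univ hn)
  have h1 : 4 * S.d k ≤ infDist (S.xk k) S.Ωᶜ := by
    rw [hyd]
    have := infDist_le_dist_of_mem (x := S.xk k) hy
    unfold d
    linarith
  exact (ball_subset_ball h1).trans ball_infDist_compl_subset

lemma ball_subset_of_norm_sub_eq (hn : 3 ≤ n) {k : ℕ} {x : Euc n} (hx : ‖x - S.xk k‖ = 2 * S.d k) :
    ball x (2 * S.d k) ⊆ S.Ω := by
  refine (ball_subset_ball' ?_).trans (S.ball_xk_subset hn k)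
  rw [dist_eq_norm, hx]
  linarith

lemma lam_pos (k : ℕ) : 0 < S.lam k := by
  rw [S.hlam_eq k]
  exact lt_max_of_lt_left (Real.rpow_pos_of_pos (S.hv_pos k _ (S.hxk k)) _)

lemma exists_G_estimates (hn : 3 ≤ n) : ∃ C : ℝ, 0 ≤ C ∧ ∀ (x z : Euc n) (r : ℝ), 0 < r →
    ball x (2 * r) ⊆ S.Ω → ball z (2 * r) ⊆ S.Ω → ‖x - z‖ = 2 * r →
    (∀ y ∈ S.Ω, y ≠ x →
      ‖S.G x y‖ ≤ C * (‖x - y‖ ^ (-((n : ℝ) - 2)) + r ^ (-((n : ℝ) - 2)))) ∧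
    ∀ y, ‖y - z‖ ≤ r / 4 → ‖S.G x y - S.G x z‖ ≤ C * ‖y - z‖ * r ^ (-((n : ℝ) - 2) - 1) := by
  have hn' : (3 : ℝ) ≤ n := by exact_mod_cast hn
  obtain ⟨C, hC, h⟩ := S.exists_H_lipschitz hn
  have hc := cGreen_nonneg hn
  have hexp : (2 : ℝ) - n = -((n : ℝ) - 2) := by ring
  refine ⟨cGreen n * ((n : ℝ) - 2) + cGreen n + C, ?_, ?_⟩
  · have : 0 ≤ cGreen n * ((n : ℝ) - 2) := mul_nonneg hc (by linarith)
    positivity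
  intro x z r hr hbx hbz hxz
  have hxO : x ∈ S.Ω := hbx (mem_ball_self (by positivity))
  have hzO : z ∈ S.Ω := hbz (mem_ball_self (by positivity))
  have hcn : 0 ≤ cGreen n * ((n : ℝ) - 2) := mul_nonneg hc (by linarith)
  constructor
  · intro y hy hyx
    have h1 := S.Gle x hxO y hy hyx.symm
    rw [Real.norm_of_nonneg (S.Gpos x hxO y hy hyx.symm).le]
    rw [hexp] at h1
    have h2 : 0 ≤ ‖x - y‖ ^ (-((n : ℝ) - 2)) := by positivity
    have h3 : 0 ≤ r ^ (-((n : ℝ) - 2)) := by positivity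
    nlinarith [mul_nonneg hcn h2, mul_nonneg hC h2, mul_nonneg hC h3, mul_nonneg hcn h3,
      mul_nonneg hc h3]
  · intro y hyz
    have hyb : y ∈ ball z r := by rw [mem_ball, dist_eq_norm]; linarith
    have hyO : y ∈ S.Ω := hbz (ball_subset_ball (by linarith) hyb)
    have habs : |‖x - y‖ - ‖x - z‖| ≤ ‖y - z‖ := by
      have := abs_norm_sub_norm_le (x - y) (x - z)
      rwa [sub_sub_sub_cancel_left, norm_sub_rev z y] at this
    have hxy : r ≤ ‖x - y‖ := by
      have := (abs_le.1 habs).1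
      linarith
    have hne : x ≠ y := by
      rintro rfl
      simp at hxy
      linarith
    have hne' : x ≠ z := by
      rintro rfl
      simp at hxz
      linarith
    rw [S.Gdecomp x hxO y hyO hne, S.Gdecomp x hxO z hzO hne', S.H_symm hxO hyO hne,
      S.H_symm hxO hzO hne', hexp, Real.norm_eq_abs]
    have h1 := h z r hr hbz x hxO y hyb z (mem_ball_self hr)
    have h2 := abs_rpow_neg_sub_le (s := (n : ℝ) - 2) (by linarith) hr hxy (b := ‖x - z‖)
      (by linarith)
    have h3 : |‖x - y‖ ^ (-((n : ℝ) - 2)) - ‖x - z‖ ^ (-((n : ℝ) - 2))|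
        ≤ ((n : ℝ) - 2) * r ^ (-((n : ℝ) - 2) - 1) * ‖y - z‖ := by
      refine h2.trans (mul_le_mul_of_nonneg_left habs ?_)
      have : (0 : ℝ) ≤ n - 2 := by linarith
      positivity
    have hexp2 : -((n : ℝ) - 1) = -((n : ℝ) - 2) - 1 := by ring
    rw [hexp2] at h1
    have h4 : 0 ≤ ‖y - z‖ * r ^ (-((n : ℝ) - 2) - 1) := by positivity
    calc _ = |cGreen n * (‖x - y‖ ^ (-((n : ℝ) - 2)) - ‖x - z‖ ^ (-((n : ℝ) - 2)))
          - (S.H y x - S.H z x)| := by congr 1; ring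
      _ ≤ |cGreen n * (‖x - y‖ ^ (-((n : ℝ) - 2)) - ‖x - z‖ ^ (-((n : ℝ) - 2)))|
          + |S.H y x - S.H z x| := abs_sub _ _
      _ ≤ cGreen n * (((n : ℝ) - 2) * r ^ (-((n : ℝ) - 2) - 1) * ‖y - z‖)
          + C * r ^ (-((n : ℝ) - 2) - 1) * ‖y - z‖ := by
        rw [abs_mul, abs_of_nonneg hc]
        gcongr
      _ ≤ _ := by nlinarith [mul_nonneg hc h4]

lemma norm_rieszKerDeriv_zero_sub_le {s r : ℝ} (hs : 0 ≤ s) (hr : 0 < r) {a b : Euc n}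
    (ha : r ≤ ‖a‖) (hb : ‖b‖ = 2 * r) :
    ‖rieszKerDeriv s 0 a - rieszKerDeriv s 0 b‖
      ≤ s * (2 * s + 5) * ‖a - b‖ * r ^ (-(s + 2)) := by
  rw [rieszKerDeriv_zero, rieszKerDeriv_zero]
  have h1 := abs_rpow_neg_sub_le (s := s + 2) (by linarith) hr ha (b := ‖b‖) (by linarith)
  have h2 : ‖a‖ ^ (-(s + 2)) ≤ r ^ (-(s + 2)) :=
    Real.rpow_le_rpow_of_nonpos hr ha (by linarith)
  have hsplit : (-s * ‖a‖ ^ (-(s + 2))) • innerSL ℝ a - (-s * ‖b‖ ^ (-(s + 2))) • innerSL ℝ b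
      = -s • (‖a‖ ^ (-(s + 2)) • innerSL ℝ (a - b)
        + (‖a‖ ^ (-(s + 2)) - ‖b‖ ^ (-(s + 2))) • innerSL ℝ b) := by
    rw [map_sub]
    module
  have hrr : r ^ (-(s + 2) - 1) * r = r ^ (-(s + 2)) := by
    rw [← Real.rpow_add_one hr.ne']
    congr 1; ring
  have hab := abs_norm_sub_norm_le a b
  rw [hb] at h1 hab
  rw [hsplit, norm_smul, norm_neg, Real.norm_of_nonneg hs]
  calc s * ‖‖a‖ ^ (-(s + 2)) • innerSL ℝ (a - b)
        + (‖a‖ ^ (-(s + 2)) - ‖b‖ ^ (-(s + 2))) • innerSL ℝ b‖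
      ≤ s * (r ^ (-(s + 2)) * ‖a - b‖ + (s + 2) * r ^ (-(s + 2) - 1) * ‖a - b‖ * (2 * r)) := by
        refine mul_le_mul_of_nonneg_left ((norm_add_le _ _).trans ?_) hs
        rw [norm_smul, norm_smul, innerSL_apply_norm, innerSL_apply_norm, hb, Real.norm_eq_abs,
          Real.norm_eq_abs, abs_of_nonneg (by positivity : 0 ≤ ‖a‖ ^ (-(s + 2)))]
        gcongr
        refine h1.trans ?_
        gcongr
    _ = s * (r ^ (-(s + 2)) * ‖a - b‖
        + 2 * (s + 2) * (r ^ (-(s + 2) - 1) * r) * ‖a - b‖) := by ring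
    _ = _ := by rw [hrr]; ring

lemma exists_Gderiv_estimates (hn : 3 ≤ n) : ∃ C : ℝ, 0 ≤ C ∧ ∀ (x z : Euc n) (r : ℝ), 0 < r →
    ball x (2 * r) ⊆ S.Ω → ball z (2 * r) ⊆ S.Ω → ‖x - z‖ = 2 * r →
    (∀ y ∈ S.Ω, y ≠ x →
      ‖S.Gderiv x y‖ ≤ C * (‖x - y‖ ^ (-((n : ℝ) - 1)) + r ^ (-((n : ℝ) - 1)))) ∧
    ∀ y, ‖y - z‖ ≤ r / 4 →
      ‖S.Gderiv x y - S.Gderiv x z‖ ≤ C * ‖y - z‖ * r ^ (-((n : ℝ) - 1) - 1) := by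
  have hn' : (3 : ℝ) ≤ n := by exact_mod_cast hn
  have hn2 : (0 : ℝ) ≤ (n : ℝ) - 2 := by linarith
  obtain ⟨C₁, hC₁, h₁⟩ := S.exists_fderiv_H_bound hn
  obtain ⟨C₂, hC₂, h₂⟩ := S.exists_fderiv_H_sub_bound hn
  have hc := cGreen_nonneg hn
  set K : ℝ := ((n : ℝ) - 2) * (2 * ((n : ℝ) - 2) + 5) with hK
  have hK0 : 0 ≤ K := by positivity
  have hKn : (n : ℝ) - 2 ≤ K := by rw [hK]; nlinarith
  refine ⟨cGreen n * K + C₁ + C₂, by positivity, ?_⟩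
  intro x z r hr hbx hbz hxz
  constructor
  · intro y hy hyx
    have h3 := h₁ x r hr hbx y hy x (mem_ball_self hr)
    have h4 := norm_rieszKerDeriv_le hn2 le_rfl (x - y)
    rw [show (n : ℝ) - 2 + 1 = n - 1 by ring] at h4
    have h5 : 0 ≤ ‖x - y‖ ^ (-((n : ℝ) - 1)) := by positivity
    have h6 : 0 ≤ r ^ (-((n : ℝ) - 1)) := by positivity
    calc ‖S.Gderiv x y‖
        ≤ cGreen n * ‖rieszKerDeriv ((n : ℝ) - 2) 0 (x - y)‖
          + ‖fderiv ℝ (fun z => S.H z y) x‖ := by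
          refine (norm_sub_le _ _).trans ?_
          rw [norm_smul, Real.norm_of_nonneg hc]
      _ ≤ cGreen n * (K * ‖x - y‖ ^ (-((n : ℝ) - 1))) + C₁ * r ^ (-((n : ℝ) - 1)) := by
          gcongr
          exact h4.trans (by gcongr)
      _ ≤ _ := by
          have : 0 ≤ cGreen n * K := by positivity
          nlinarith [mul_nonneg this h6, mul_nonneg hC₁ h5, mul_nonneg hC₂ h5, mul_nonneg hC₂ h6]
  · intro y hyz
    have hyb : y ∈ ball z r := by rw [mem_ball, dist_eq_norm]; linarith
    have hxy : r ≤ ‖x - y‖ := by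
      have := norm_sub_norm_le (x - z) (y - z)
      rw [sub_sub_sub_cancel_right] at this
      linarith
    have h3 := h₂ x z r hr hbx hbz y hyb z (mem_ball_self hr)
    have h4 := norm_rieszKerDeriv_zero_sub_le (n := n) hn2 hr hxy hxz
    rw [sub_sub_sub_cancel_left, norm_sub_rev z y, ← hK, show (n : ℝ) - 2 + 2 = n by ring] at h4
    rw [show -((n : ℝ) - 1) - 1 = -(n : ℝ) by ring]
    have hsplit : S.Gderiv x y - S.Gderiv x z = cGreen n • (rieszKerDeriv ((n : ℝ) - 2) 0 (x - y)
        - rieszKerDeriv ((n : ℝ) - 2) 0 (x - z))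
        - (fderiv ℝ (fun w => S.H w y) x - fderiv ℝ (fun w => S.H w z) x) := by
      unfold Gderiv
      rw [smul_sub]
      abel
    have h6 : 0 ≤ ‖y - z‖ * r ^ (-(n : ℝ)) := by positivity
    calc ‖S.Gderiv x y - S.Gderiv x z‖
        ≤ cGreen n * (K * ‖y - z‖ * r ^ (-(n : ℝ))) + C₂ * r ^ (-(n : ℝ)) * ‖y - z‖ := by
          rw [hsplit]
          refine (norm_sub_le _ _).trans ?_
          rw [norm_smul, Real.norm_of_nonneg hc]
          gcongr
      _ ≤ _ := by nlinarith [mul_nonneg hC₁ h6]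

end BlowupSetup

/-- Concentration of `f` near `z` makes `∫ f • T` close to a multiple of `T z`. -/
lemma norm_setIntegral_smul_sub_le {n : ℕ} {F : Type*} [NormedAddCommGroup F] [NormedSpace ℝ F]
    [CompleteSpace F] {O : Set (Euc n)} (hO : MeasurableSet O) {f : Euc n → ℝ}
    (hf0 : ∀ y ∈ O, 0 ≤ f y) (hfi : IntegrableOn f O) {T : Euc n → F}
    (hT : IntegrableOn (fun y => f y • T y) O) {x z : Euc n} {r K s B A C : ℝ} (hr : 0 < r)
    (hK : 0 ≤ K) (hs : 0 ≤ s) (hxz : ‖x - z‖ = 2 * r) (hx : x ∈ O) (hz : z ∈ O)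
    (hn : 1 ≤ n) (hB0 : 0 ≤ B)
    (hT1 : ∀ y ∈ O, y ≠ x → ‖T y‖ ≤ K * (‖x - y‖ ^ (-s) + r ^ (-s)))
    (hT2 : ∀ y, ‖y - z‖ ≤ r / 4 → ‖T y - T z‖ ≤ K * ‖y - z‖ * r ^ (-s - 1))
    (hB : ∀ y ∈ O, y ∈ ball x r → f y ≤ B)
    (hi : IntegrableOn (fun w => ‖w - x‖ ^ (-s)) (ball x r))
    (hC : ∫ w in ball x r, ‖w - x‖ ^ (-s) ≤ C * r ^ ((n : ℝ) - s)) :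
    ‖(∫ y in O, f y • T y) - A • T z‖ ≤ 16 * K * r ^ (-s) *
      ((∫ y in O, f y * min 1 (‖y - z‖ / r)) + B * C * r ^ (n : ℝ) + |(∫ y in O, f y) - A|) := by
  have hrs : 0 < r ^ (-s) := by positivity
  have hzx : z ≠ x := by
    rintro rfl
    simp at hxz
    linarith
  have hTz : ‖T z‖ ≤ 2 * K * r ^ (-s) := by
    have h1 := hT1 z hz hzx
    rw [hxz] at h1
    have h2 : (2 * r) ^ (-s) ≤ r ^ (-s) :=
      Real.rpow_le_rpow_of_nonpos hr (by linarith) (by linarith)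
    nlinarith
  set g : Euc n → ℝ := (ball x r).indicator (fun w => ‖w - x‖ ^ (-s)) with hg
  have hg0 : ∀ y, 0 ≤ g y := fun y => Set.indicator_nonneg (fun w _ => by positivity) y
  have hmin0 : ∀ y, 0 ≤ min 1 (‖y - z‖ / r) := fun y => le_min zero_le_one (by positivity)
  have hpt : ∀ y ∈ O, y ≠ x →
      ‖T y - T z‖ ≤ 16 * K * (r ^ (-s) * min 1 (‖y - z‖ / r) + g y) := by
    intro y hy hyx
    rcases le_or_gt ‖y - z‖ (r / 4) with h | h
    · have h1 : min 1 (‖y - z‖ / r) = ‖y - z‖ / r := by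
        refine min_eq_right ?_
        rw [div_le_one hr]
        linarith
      have h2 : K * ‖y - z‖ * r ^ (-s - 1) = K * (r ^ (-s) * min 1 (‖y - z‖ / r)) := by
        rw [h1, Real.rpow_sub_one hr.ne']
        ring
      have h3 := hT2 y h
      rw [h2] at h3
      have h4 : 0 ≤ r ^ (-s) * min 1 (‖y - z‖ / r) := mul_nonneg hrs.le (hmin0 y)
      nlinarith [mul_nonneg hK h4, mul_nonneg hK (hg0 y)]
    · have h1 : 1 / 4 ≤ min 1 (‖y - z‖ / r) := by
        refine le_min (by norm_num) ?_
        rw [le_div_iff₀ hr]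
        linarith
      have h2 : ‖x - y‖ ^ (-s) ≤ r ^ (-s) + g y := by
        by_cases hyb : y ∈ ball x r
        · rw [hg, Set.indicator_of_mem hyb, norm_sub_rev]
          linarith
        · have h3 : ‖x - y‖ ^ (-s) ≤ r ^ (-s) := by
            refine Real.rpow_le_rpow_of_nonpos hr ?_ (by linarith)
            rw [mem_ball, dist_eq_norm, norm_sub_rev] at hyb
            exact not_lt.1 hyb
          linarith [hg0 y]
      have h5 : ‖T y - T z‖ ≤ K * (4 * r ^ (-s) + g y) := by
        refine (norm_sub_le _ _).trans ?_
        have := hT1 y hy hyx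
        nlinarith [mul_le_mul_of_nonneg_left h2 hK]
      have h6 : r ^ (-s) * (1 / 4) ≤ r ^ (-s) * min 1 (‖y - z‖ / r) := by gcongr
      refine h5.trans ?_
      nlinarith [mul_le_mul_of_nonneg_left h6 hK, mul_nonneg hK (hg0 y)]
  have hfm : IntegrableOn (fun y => f y * min 1 (‖y - z‖ / r)) O := by
    refine Integrable.mul_bdd hfi (c := 1) (by fun_prop) (Eventually.of_forall fun y => ?_)
    rw [Real.norm_of_nonneg (hmin0 y)]
    exact min_le_left _ _
  have hgi : Integrable g := (integrable_indicator_iff measurableSet_ball).2 hi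
  have hsplit : (∫ y in O, f y • T y) - A • T z
      = (∫ y in O, f y • (T y - T z)) + ((∫ y in O, f y) - A) • T z := by
    simp_rw [smul_sub]
    rw [integral_sub hT (hfi.smul_const _), integral_smul_const, sub_smul]
    abel
  have h1 : ‖∫ y in O, f y • (T y - T z)‖ ≤
      ∫ y in O, (16 * K * r ^ (-s) * (f y * min 1 (‖y - z‖ / r)) + 16 * K * B * g y) := by
    refine norm_integral_le_of_norm_le
      ((hfm.const_mul _).add (hgi.integrableOn.const_mul _)) ?_
    filter_upwards [ae_restrict_mem hO,
      ae_ne_of_dim hn _ Measure.absolutelyContinuous_restrict x] with y hy hyx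
    rw [norm_smul, Real.norm_of_nonneg (hf0 y hy)]
    have h2 : f y * g y ≤ B * g y := by
      by_cases hyb : y ∈ ball x r
      · exact mul_le_mul_of_nonneg_right (hB y hy hyb) (hg0 y)
      · rw [hg, Set.indicator_of_notMem hyb]; simp
    calc f y * ‖T y - T z‖ ≤ f y * (16 * K * (r ^ (-s) * min 1 (‖y - z‖ / r) + g y)) :=
          mul_le_mul_of_nonneg_left (hpt y hy hyx) (hf0 y hy)
      _ = 16 * K * r ^ (-s) * (f y * min 1 (‖y - z‖ / r)) + 16 * K * (f y * g y) := by ring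
      _ ≤ _ := by nlinarith [mul_le_mul_of_nonneg_left h2 hK]
  have h2 : ∫ y in O, g y ≤ C * r ^ ((n : ℝ) - s) := by
    refine (setIntegral_le_integral hgi (Eventually.of_forall hg0)).trans ?_
    rwa [hg, integral_indicator measurableSet_ball]
  have h3 : r ^ ((n : ℝ) - s) = r ^ (-s) * r ^ (n : ℝ) := by
    rw [← Real.rpow_add hr]; congr 1; ring
  rw [integral_add (hfm.const_mul _) (hgi.integrableOn.const_mul _), integral_const_mul,
    integral_const_mul] at h1
  rw [hsplit]
  calc _ ≤ ‖∫ y in O, f y • (T y - T z)‖ + |(∫ y in O, f y) - A| * ‖T z‖ := by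
        refine (norm_add_le _ _).trans ?_
        rw [norm_smul, Real.norm_eq_abs]
    _ ≤ (16 * K * r ^ (-s) * (∫ y in O, f y * min 1 (‖y - z‖ / r))
          + 16 * K * B * (C * (r ^ (-s) * r ^ (n : ℝ))))
        + |(∫ y in O, f y) - A| * (2 * K * r ^ (-s)) := by
        rw [← h3]
        gcongr
        refine h1.trans ?_
        gcongr
    _ ≤ _ := by
        have : 0 ≤ |(∫ y in O, f y) - A| * (K * r ^ (-s)) := by positivity
        nlinarith

namespace BlowupSetup

variable {n : ℕ} (S : BlowupSetup n)

lemma one_div_qk_add_one (k : ℕ) : 1 / (S.qk k + 1) = 1 / (S.q + 1) + S.eps k := by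
  have h1 := S.hpq
  have h2 := S.hqk_eq k
  linarith

lemma qk_lt_q (k : ℕ) : S.qk k < S.q := by
  have h1 := S.one_div_qk_add_one k
  have h2 := S.heps k
  have h3 : 1 / (S.q + 1) < 1 / (S.qk k + 1) := by linarith
  have := (one_div_lt_one_div (by linarith [S.hq]) (by linarith [S.hqk k])).1 h3
  linarith

lemma tendsto_qk : Tendsto S.qk atTop (𝓝 S.q) := by
  have hq : S.q + 1 ≠ 0 := by linarith [S.hq]
  have h : S.qk = fun k => (1 / (S.q + 1) + S.eps k)⁻¹ - 1 := by
    ext k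
    rw [← S.one_div_qk_add_one k, one_div, inv_inv]
    ring
  rw [h]
  have h1 : Tendsto (fun k => 1 / (S.q + 1) + S.eps k) atTop (𝓝 (1 / (S.q + 1) + 0)) :=
    S.heps0.const_add _
  have h2 := (h1.inv₀ (by simpa using hq)).sub_const 1
  simpa using h2

lemma dim_lt_mul_q (hn : 3 ≤ n) (hp : S.p ≤ ((n : ℝ) + 2) / ((n : ℝ) - 2)) :
    (n : ℝ) < ((n : ℝ) - 2) * S.q := by
  have hn' : (3 : ℝ) ≤ n := by exact_mod_cast hn
  have hn2 : (0 : ℝ) < (n : ℝ) - 2 := by linarith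
  have hq := S.hq
  have hp1 : S.p + 1 ≤ 2 * n / ((n : ℝ) - 2) := by
    have : 2 * (n : ℝ) / (n - 2) = (n + 2) / (n - 2) + 1 := by field_simp; ring
    linarith
  have h1 : ((n : ℝ) - 2) / (2 * n) ≤ 1 / (S.p + 1) := by
    have := one_div_le_one_div_of_le (by linarith [S.hp]) hp1
    rwa [one_div_div] at this
  have h2 : 1 / (S.q + 1) ≤ ((n : ℝ) - 2) / (2 * n) := by
    have h3 := S.hpq
    have h4 : ((n : ℝ) - 2) / n = (n - 2) / (2 * n) + (n - 2) / (2 * n) := by field_simp; ring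
    linarith
  rw [div_le_div_iff₀ (by linarith) (by linarith)] at h2
  linarith

/-- The rescaling of `u_k ^ q_k` around `x_k`, extended by zero. -/
def rescaled (k : ℕ) (z : Euc n) : ℝ :=
  S.Ω.indicator (fun y => (S.lam k ^ (-((n : ℝ) / (S.qk k + 1))) * S.u k y) ^ S.qk k)
    ((S.lam k)⁻¹ • z + S.xk k)

lemma rescaled_nonneg (k : ℕ) (z : Euc n) : 0 ≤ S.rescaled k z := by
  refine Set.indicator_nonneg (fun y hy => ?_) _
  have := (S.hu_pos k y hy).le
  have := (S.lam_pos k).le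
  positivity

lemma measurable_rescaled (k : ℕ) : Measurable (S.rescaled k) := by
  have h : Measurable (S.Ω.indicator
      (fun y => (S.lam k ^ (-((n : ℝ) / (S.qk k + 1))) * S.u k y) ^ S.qk k)) := by
    classical
    rw [← Set.piecewise_eq_indicator]
    refine ContinuousOn.measurable_piecewise ?_ continuousOn_const S.hΩo.measurableSet
    exact ((S.hu_cont k).const_mul _).rpow_const fun y hy => Or.inr (S.hqk k).le
  exact h.comp (by fun_prop)

lemma mul_setIntegral_eq (hn : 3 ≤ n) (k : ℕ) (w : Euc n → ℝ) :
    S.lam k ^ ((n : ℝ) / (S.qk k + 1)) * ∫ y in S.Ω, S.u k y ^ S.qk k * w y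
      = ∫ z, S.rescaled k z * w ((S.lam k)⁻¹ • z + S.xk k) := by
  have hl := S.lam_pos k
  have hq := S.hqk k
  set g : Euc n → ℝ := S.Ω.indicator fun y => S.u k y ^ S.qk k * w y with hg
  have h1 : ∫ y in S.Ω, S.u k y ^ S.qk k * w y = ∫ y, g y :=
    (integral_indicator S.hΩo.measurableSet).symm
  have h2 : ∫ z, g ((S.lam k)⁻¹ • z + S.xk k) = S.lam k ^ n * ∫ y, g y := by
    rw [Measure.integral_comp_smul volume (fun z => g (z + S.xk k)) (S.lam k)⁻¹,
      integral_add_right_eq_self g, finrank_euclideanSpace_fin, smul_eq_mul, inv_pow, inv_inv,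
      abs_of_pos (by positivity)]
  have h3 : ∀ z, S.rescaled k z * w ((S.lam k)⁻¹ • z + S.xk k)
      = (S.lam k ^ (-((n : ℝ) / (S.qk k + 1)))) ^ S.qk k * g ((S.lam k)⁻¹ • z + S.xk k) := by
    intro z
    unfold rescaled
    by_cases hz : (S.lam k)⁻¹ • z + S.xk k ∈ S.Ω
    · rw [hg, Set.indicator_of_mem hz, Set.indicator_of_mem hz,
        Real.mul_rpow (by positivity) (S.hu_pos k _ hz).le]
      ring
    · rw [hg, Set.indicator_of_notMem hz, Set.indicator_of_notMem hz]
      simp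
  simp_rw [h3]
  rw [integral_const_mul, h2, h1, ← mul_assoc]
  congr 1
  rw [← Real.rpow_natCast, ← Real.rpow_mul hl.le, ← Real.rpow_add hl]
  congr 1
  field_simp
  ring

lemma rescaled_le {C₀ : ℝ} (hC₀ : 0 < C₀)
    (hubd : ∀ k, ∀ y ∈ S.Ω,
      S.u k y ≤ C₀ * S.lam k ^ ((n : ℝ) / (S.qk k + 1))
        * (1 + S.lam k * ‖y - S.xk k‖) ^ ((2 : ℝ) - n))
    {q₀ : ℝ} (hn : 3 ≤ n) {k : ℕ} (hk : q₀ ≤ S.qk k) (z : Euc n) :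
    S.rescaled k z ≤ max 1 C₀ ^ S.q * (1 + ‖z‖) ^ (-(((n : ℝ) - 2) * q₀)) := by
  have hn' : (3 : ℝ) ≤ n := by exact_mod_cast hn
  have hl := S.lam_pos k
  have hq := S.hqk k
  have h1z : 1 ≤ 1 + ‖z‖ := by linarith [norm_nonneg z]
  unfold rescaled
  by_cases hz : (S.lam k)⁻¹ • z + S.xk k ∈ S.Ω
  · rw [Set.indicator_of_mem hz]
    have h1 := hubd k _ hz
    have hu := S.hu_pos k _ hz
    rw [add_sub_cancel_right, norm_smul, norm_inv, Real.norm_of_nonneg hl.le,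
      mul_inv_cancel_left₀ hl.ne'] at h1
    have h2 : S.lam k ^ (-((n : ℝ) / (S.qk k + 1))) * S.u k ((S.lam k)⁻¹ • z + S.xk k)
        ≤ C₀ * (1 + ‖z‖) ^ ((2 : ℝ) - n) := by
      rw [Real.rpow_neg hl.le, inv_mul_le_iff₀ (by positivity)]
      linarith
    calc _ ≤ (C₀ * (1 + ‖z‖) ^ ((2 : ℝ) - n)) ^ S.qk k :=
          Real.rpow_le_rpow (by positivity) h2 hq.le
      _ = C₀ ^ S.qk k * (1 + ‖z‖) ^ (((2 : ℝ) - n) * S.qk k) := by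
          rw [Real.mul_rpow hC₀.le (by positivity), ← Real.rpow_mul (by positivity)]
      _ ≤ _ := by
          gcongr
          · calc C₀ ^ S.qk k ≤ max 1 C₀ ^ S.qk k :=
                  Real.rpow_le_rpow hC₀.le (le_max_right _ _) hq.le
              _ ≤ _ := Real.rpow_le_rpow_of_exponent_le (le_max_left _ _) (S.qk_lt_q k).le
          · nlinarith
  · rw [Set.indicator_of_notMem hz]
    positivity

lemma u_rpow_le {C₀ : ℝ} (hC₀ : 0 < C₀)
    (hubd : ∀ k, ∀ y ∈ S.Ω,
      S.u k y ≤ C₀ * S.lam k ^ ((n : ℝ) / (S.qk k + 1))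
        * (1 + S.lam k * ‖y - S.xk k‖) ^ ((2 : ℝ) - n))
    {k : ℕ} (hn : 3 ≤ n) {y : Euc n} (hy : y ∈ S.Ω) :
    S.u k y ^ S.qk k ≤ (C₀ * S.lam k ^ ((n : ℝ) / (S.qk k + 1))) ^ S.qk k := by
  have hn' : (3 : ℝ) ≤ n := by exact_mod_cast hn
  have hl := S.lam_pos k
  refine Real.rpow_le_rpow (S.hu_pos k y hy).le ((hubd k y hy).trans ?_) (S.hqk k).le
  refine mul_le_of_le_one_right (by positivity) ?_
  refine Real.rpow_le_one_of_one_le_of_nonpos ?_ (by linarith)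
  have : 0 ≤ S.lam k * ‖y - S.xk k‖ := by positivity
  linarith

lemma aestronglyMeasurable_u_rpow (k : ℕ) :
    AEStronglyMeasurable (fun y => S.u k y ^ S.qk k) (volume.restrict S.Ω) :=
  ((S.hu_cont k).rpow_const fun _ _ => Or.inr (S.hqk k).le).aestronglyMeasurable
    S.hΩo.measurableSet

lemma integrableOn_u_rpow {C₀ : ℝ} (hC₀ : 0 < C₀)
    (hubd : ∀ k, ∀ y ∈ S.Ω,
      S.u k y ≤ C₀ * S.lam k ^ ((n : ℝ) / (S.qk k + 1))
        * (1 + S.lam k * ‖y - S.xk k‖) ^ ((2 : ℝ) - n))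
    (hn : 3 ≤ n) (k : ℕ) : IntegrableOn (fun y => S.u k y ^ S.qk k) S.Ω := by
  refine IntegrableOn.of_bound S.hΩb.measure_lt_top (S.aestronglyMeasurable_u_rpow k)
    ((C₀ * S.lam k ^ ((n : ℝ) / (S.qk k + 1))) ^ S.qk k) ?_
  filter_upwards [ae_restrict_mem S.hΩo.measurableSet] with y hy
  rw [Real.norm_of_nonneg (Real.rpow_nonneg (S.hu_pos k y hy).le _)]
  exact S.u_rpow_le hC₀ hubd hn hy

lemma tendsto_integral_rescaled {C₀ : ℝ} (hC₀ : 0 < C₀)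
    (hubd : ∀ k, ∀ y ∈ S.Ω,
      S.u k y ≤ C₀ * S.lam k ^ ((n : ℝ) / (S.qk k + 1))
        * (1 + S.lam k * ‖y - S.xk k‖) ^ ((2 : ℝ) - n))
    (hn : 3 ≤ n) (hq : (n : ℝ) < ((n : ℝ) - 2) * S.q)
    {U : Euc n → ℝ} (hUpos : ∀ x, 0 < U x)
    (hUlim : ∀ x : Euc n,
      Tendsto
        (fun k => S.lam k ^ (-((n : ℝ) / (S.qk k + 1))) * S.u k ((S.lam k)⁻¹ • x + S.xk k))
        atTop (𝓝 (U x)))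
    {w : ℕ → Euc n → ℝ} (hwm : ∀ k, Measurable (w k)) (hw : ∀ k z, |w k z| ≤ 1)
    {W : Euc n → ℝ} (hW : ∀ z, Tendsto (fun k => w k z) atTop (𝓝 (W z))) :
    Tendsto (fun k => ∫ z, S.rescaled k z * w k z) atTop (𝓝 (∫ z, U z ^ S.q * W z)) := by
  have hn' : (3 : ℝ) ≤ n := by exact_mod_cast hn
  have hn2 : (0 : ℝ) < (n : ℝ) - 2 := by linarith
  obtain ⟨q₀, hq₀, hq₀q⟩ := exists_between ((div_lt_iff₀' hn2).2 hq)
  have hq₀' : (n : ℝ) < ((n : ℝ) - 2) * q₀ := (div_lt_iff₀' hn2).1 hq₀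
  refine tendsto_integral_filter_of_dominated_convergence
    (fun z => max 1 C₀ ^ S.q * (1 + ‖z‖) ^ (-(((n : ℝ) - 2) * q₀))) ?_ ?_ ?_ ?_
  · exact Eventually.of_forall fun k =>
      ((S.measurable_rescaled k).mul (hwm k)).aestronglyMeasurable
  · filter_upwards [S.tendsto_qk.eventually (lt_mem_nhds hq₀q)] with k hk
    refine Eventually.of_forall fun z => ?_
    rw [norm_mul, Real.norm_of_nonneg (S.rescaled_nonneg k z), Real.norm_eq_abs]
    exact (mul_le_of_le_one_right (S.rescaled_nonneg k z) (hw k z)).trans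
      (S.rescaled_le hC₀ hubd hn hk.le z)
  · refine (integrable_one_add_norm ?_).const_mul _
    rwa [finrank_euclideanSpace_fin]
  · refine Eventually.of_forall fun z => ?_
    refine Tendsto.mul ?_ (hW z)
    refine ((hUlim z).rpow S.tendsto_qk (Or.inl (hUpos z).ne')).congr' ?_
    filter_upwards [S.hN_top.eventually_gt_atTop ‖z‖] with k hk
    have hmem : (S.lam k)⁻¹ • z + S.xk k ∈ S.Ω := by
      refine S.ball_xk_subset hn k ?_
      have hl := S.lam_pos k
      have hd := S.d_pos hn k
      rw [mem_ball, dist_eq_norm, add_sub_cancel_right, norm_smul, norm_inv,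
        Real.norm_of_nonneg hl.le, inv_mul_lt_iff₀ hl]
      change ‖z‖ < S.lam k * S.d k at hk
      nlinarith [mul_pos hl hd]
    rw [rescaled, Set.indicator_of_mem hmem]

/-- The relative error in the estimate on the annulus. -/
def annulusError (C₀ A : ℝ) (k : ℕ) : ℝ :=
  S.lam k ^ ((n : ℝ) / (S.qk k + 1)) *
      (∫ y in S.Ω, S.u k y ^ S.qk k * min 1 (‖y - S.xk k‖ / S.d k))
    + C₀ ^ S.qk k * S.N k ^ ((n : ℝ) - ((n : ℝ) - 2) * S.qk k)
    + |S.lam k ^ ((n : ℝ) / (S.qk k + 1)) * (∫ y in S.Ω, S.u k y ^ S.qk k) - A|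

lemma annulusError_nonneg (hn : 3 ≤ n) {C₀ : ℝ} (hC₀ : 0 < C₀) (A : ℝ) (k : ℕ) :
    0 ≤ S.annulusError C₀ A k := by
  have hl := S.lam_pos k
  have hd := S.d_pos hn k
  have hN : 0 < S.N k := mul_pos hl hd
  have h1 : 0 ≤ ∫ y in S.Ω, S.u k y ^ S.qk k * min 1 (‖y - S.xk k‖ / S.d k) := by
    refine setIntegral_nonneg S.hΩo.measurableSet fun y hy => ?_
    have := (S.hu_pos k y hy).le
    positivity
  unfold annulusError
  positivity

lemma tendsto_annulusError {C₀ : ℝ} (hC₀ : 0 < C₀)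
    (hubd : ∀ k, ∀ y ∈ S.Ω,
      S.u k y ≤ C₀ * S.lam k ^ ((n : ℝ) / (S.qk k + 1))
        * (1 + S.lam k * ‖y - S.xk k‖) ^ ((2 : ℝ) - n))
    (hn : 3 ≤ n) (hq : (n : ℝ) < ((n : ℝ) - 2) * S.q)
    {U : Euc n → ℝ} (hUpos : ∀ x, 0 < U x)
    (hUlim : ∀ x : Euc n,
      Tendsto
        (fun k => S.lam k ^ (-((n : ℝ) / (S.qk k + 1))) * S.u k ((S.lam k)⁻¹ • x + S.xk k))
        atTop (𝓝 (U x))) :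
    Tendsto (S.annulusError C₀ (∫ y, U y ^ S.q)) atTop (𝓝 0) := by
  have hn' : (3 : ℝ) ≤ n := by exact_mod_cast hn
  have hn2 : (0 : ℝ) < (n : ℝ) - 2 := by linarith
  have hNtop : Tendsto S.N atTop atTop := S.hN_top
  have hNpos : ∀ k, 0 < S.N k := fun k => mul_pos (S.lam_pos k) (S.d_pos hn k)
  have h1 : Tendsto (fun k => S.lam k ^ ((n : ℝ) / (S.qk k + 1)) *
      (∫ y in S.Ω, S.u k y ^ S.qk k * min 1 (‖y - S.xk k‖ / S.d k))) atTop (𝓝 0) := by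
    have h := S.tendsto_integral_rescaled hC₀ hubd hn hq hUpos hUlim
      (w := fun k z => min 1 (‖z‖ / S.N k)) (W := fun _ => 0) (fun k => by fun_prop)
      (fun k z => by
        have := hNpos k
        rw [abs_of_nonneg (by positivity)]
        exact min_le_left _ _)
      (fun z => by
        have h0 : Tendsto (fun k => ‖z‖ / S.N k) atTop (𝓝 0) := hNtop.const_div_atTop _
        simpa using (tendsto_const_nhds (x := (1 : ℝ))).min h0)
    simp only [mul_zero, integral_zero] at h
    refine h.congr fun k => ?_
    rw [S.mul_setIntegral_eq hn k]
    refine integral_congr_ae (Eventually.of_forall fun z => ?_)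
    have hl := S.lam_pos k
    simp only [add_sub_cancel_right, norm_smul, norm_inv, Real.norm_of_nonneg hl.le]
    rw [inv_mul_eq_div, div_div]
    rfl
  have h2 : Tendsto (fun k => S.lam k ^ ((n : ℝ) / (S.qk k + 1)) *
      (∫ y in S.Ω, S.u k y ^ S.qk k)) atTop (𝓝 (∫ y, U y ^ S.q)) := by
    have h := S.tendsto_integral_rescaled hC₀ hubd hn hq hUpos hUlim
      (w := fun _ _ => 1) (W := fun _ => 1) (fun k => by fun_prop) (fun k z => by simp)
      (fun z => tendsto_const_nhds)
    simp only [mul_one] at h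
    refine h.congr fun k => ?_
    simpa using (S.mul_setIntegral_eq hn k fun _ => 1).symm
  have h3 : Tendsto (fun k => C₀ ^ S.qk k * S.N k ^ ((n : ℝ) - ((n : ℝ) - 2) * S.qk k)) atTop
      (𝓝 0) := by
    obtain ⟨q₀, hq₀, hq₀q⟩ := exists_between ((div_lt_iff₀' hn2).2 hq)
    have hq₀' : (n : ℝ) < ((n : ℝ) - 2) * q₀ := (div_lt_iff₀' hn2).1 hq₀
    have h4 : Tendsto (fun k => S.N k ^ (-(((n : ℝ) - 2) * q₀ - n))) atTop (𝓝 0) :=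
      (tendsto_rpow_neg_atTop (by linarith)).comp hNtop
    have h5 : Tendsto (fun k => S.N k ^ ((n : ℝ) - ((n : ℝ) - 2) * S.qk k)) atTop (𝓝 0) := by
      refine squeeze_zero' (Eventually.of_forall fun k => (Real.rpow_pos_of_pos (hNpos k) _).le)
        ?_ h4
      filter_upwards [S.tendsto_qk.eventually (lt_mem_nhds hq₀q),
        hNtop.eventually_ge_atTop 1] with k hk hN1
      refine Real.rpow_le_rpow_of_exponent_le hN1 ?_
      nlinarith
    simpa using ((tendsto_const_nhds (x := C₀)).rpow S.tendsto_qk (Or.inl hC₀.ne')).mul h5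
  have h6 := (h1.add h3).add (h2.sub_const (∫ y, U y ^ S.q)).abs
  rw [sub_self, abs_zero, add_zero, add_zero] at h6
  exact h6

end BlowupSetup

namespace BlowupSetup

variable {n : ℕ} (S : BlowupSetup n)

lemma norm_setIntegral_smul_sub_le_annulusError (hn : 3 ≤ n) {C₀ : ℝ} (hC₀ : 0 < C₀)
    (hubd : ∀ k, ∀ y ∈ S.Ω,
      S.u k y ≤ C₀ * S.lam k ^ ((n : ℝ) / (S.qk k + 1))
        * (1 + S.lam k * ‖y - S.xk k‖) ^ ((2 : ℝ) - n))
    {F : Type*} [NormedAddCommGroup F] [NormedSpace ℝ F] [CompleteSpace F] {T : Euc n → F}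
    {A K C s : ℝ} (hK : 0 ≤ K) (hC : 0 ≤ C) (hs : 0 ≤ s)
    {k : ℕ} {x : Euc n} (hx : ‖x - S.xk k‖ = 2 * S.d k)
    (hT : IntegrableOn (fun y => S.u k y ^ S.qk k • T y) S.Ω)
    (hT1 : ∀ y ∈ S.Ω, y ≠ x → ‖T y‖ ≤ K * (‖x - y‖ ^ (-s) + S.d k ^ (-s)))
    (hT2 : ∀ y, ‖y - S.xk k‖ ≤ S.d k / 4 →
      ‖T y - T (S.xk k)‖ ≤ K * ‖y - S.xk k‖ * S.d k ^ (-s - 1))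
    (hi : IntegrableOn (fun w => ‖w - x‖ ^ (-s)) (ball x (S.d k)))
    (hCi : ∫ w in ball x (S.d k), ‖w - x‖ ^ (-s) ≤ C * S.d k ^ ((n : ℝ) - s)) :
    ‖(∫ y in S.Ω, S.u k y ^ S.qk k • T y)
        - (A * S.lam k ^ (-((n : ℝ) / (S.qk k + 1)))) • T (S.xk k)‖
      ≤ 16 * K * (1 + C) * S.annulusError C₀ A k * S.lam k ^ (-((n : ℝ) / (S.qk k + 1)))
        * S.d k ^ (-s) := by
  have hn' : (3 : ℝ) ≤ n := by exact_mod_cast hn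
  have hl := S.lam_pos k
  have hd := S.d_pos hn k
  have hq := S.hqk k
  have hN : 0 < S.N k := mul_pos hl hd
  set L : ℝ := S.lam k ^ ((n : ℝ) / (S.qk k + 1)) with hL
  have hLpos : 0 < L := by positivity
  have hLinv : S.lam k ^ (-((n : ℝ) / (S.qk k + 1))) = L⁻¹ := by rw [Real.rpow_neg hl.le]
  have hxO : x ∈ S.Ω :=
    S.ball_subset_of_norm_sub_eq hn hx (mem_ball_self (by positivity))
  have hfi : IntegrableOn (fun y => S.u k y ^ S.qk k) S.Ω := S.integrableOn_u_rpow hC₀ hubd hn k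
  set B : ℝ := (C₀ * L * S.N k ^ ((2 : ℝ) - n)) ^ S.qk k with hB
  have hB0 : 0 ≤ B := by positivity
  have hBle : ∀ y ∈ S.Ω, y ∈ ball x (S.d k) → S.u k y ^ S.qk k ≤ B := by
    intro y hy hyx
    refine Real.rpow_le_rpow (S.hu_pos k y hy).le ((hubd k y hy).trans ?_) hq.le
    have h1 : S.d k ≤ ‖y - S.xk k‖ := by
      rw [mem_ball, dist_eq_norm, norm_sub_rev] at hyx
      have := norm_sub_norm_le (x - S.xk k) (x - y)
      rw [sub_sub_sub_cancel_left] at this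
      linarith
    have h2 : S.N k ≤ 1 + S.lam k * ‖y - S.xk k‖ := by
      have : S.lam k * S.d k ≤ S.lam k * ‖y - S.xk k‖ := by gcongr
      unfold N
      linarith
    refine mul_le_mul_of_nonneg_left ?_ (by positivity)
    exact Real.rpow_le_rpow_of_nonpos hN h2 (by linarith)
  have hBd : L * (B * S.d k ^ (n : ℝ))
      = C₀ ^ S.qk k * S.N k ^ ((n : ℝ) - ((n : ℝ) - 2) * S.qk k) := by
    have h1 : L * L ^ S.qk k = S.lam k ^ (n : ℝ) := by
      rw [hL, ← Real.rpow_mul hl.le, ← Real.rpow_add hl]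
      congr 1
      field_simp
      ring
    have h2 : S.N k ^ (n : ℝ) = S.lam k ^ (n : ℝ) * S.d k ^ (n : ℝ) :=
      Real.mul_rpow hl.le hd.le
    rw [hB, Real.mul_rpow (by positivity) (by positivity), Real.mul_rpow hC₀.le hLpos.le,
      ← Real.rpow_mul hN.le,
      show (n : ℝ) - ((n : ℝ) - 2) * S.qk k = n + (2 - n) * S.qk k by ring,
      Real.rpow_add hN, h2, ← h1]
    ring
  have hmain := norm_setIntegral_smul_sub_le S.hΩo.measurableSet
    (fun y hy => Real.rpow_nonneg (S.hu_pos k y hy).le _) hfi hT (A := A * L⁻¹) hd hK hs hx hxO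
    (S.hxk k) (by omega) hB0 hT1 hT2 hBle hi hCi
  rw [hLinv]
  refine hmain.trans ?_
  have hI : 0 ≤ ∫ y in S.Ω, S.u k y ^ S.qk k * min 1 (‖y - S.xk k‖ / S.d k) := by
    refine setIntegral_nonneg S.hΩo.measurableSet fun y hy => ?_
    have := (S.hu_pos k y hy).le
    positivity
  set I := ∫ y in S.Ω, S.u k y ^ S.qk k * min 1 (‖y - S.xk k‖ / S.d k) with hI_def
  set J := ∫ y in S.Ω, S.u k y ^ S.qk k with hJ_def
  have habs : |J - A * L⁻¹| = L⁻¹ * |L * J - A| := by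
    rw [← abs_of_pos (inv_pos.2 hLpos), ← abs_mul, abs_of_pos (inv_pos.2 hLpos)]
    congr 1
    field_simp
  have herr : S.annulusError C₀ A k = L * I + L * (B * S.d k ^ (n : ℝ)) + |L * J - A| := by
    rw [hBd]
    rfl
  have hds : 0 ≤ S.d k ^ (-s) := by positivity
  have hle : I + B * C * S.d k ^ (n : ℝ) + |J - A * L⁻¹|
      ≤ (1 + C) * S.annulusError C₀ A k * L⁻¹ := by
    rw [herr, habs]
    have hexp : (1 + C) * (L * I + L * (B * S.d k ^ (n : ℝ)) + |L * J - A|) * L⁻¹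
        = (1 + C) * (I + B * S.d k ^ (n : ℝ) + L⁻¹ * |L * J - A|) := by
      field_simp
    rw [hexp]
    have h1 : 0 ≤ B * S.d k ^ (n : ℝ) := by positivity
    have h2 : 0 ≤ L⁻¹ * |L * J - A| := by positivity
    nlinarith [mul_nonneg hC hI, mul_nonneg hC h2]
  calc _ ≤ 16 * K * S.d k ^ (-s) * ((1 + C) * S.annulusError C₀ A k * L⁻¹) := by gcongr
    _ = _ := by ring

lemma hasFDerivAt_v (hn : 3 ≤ n) {C₀ : ℝ} (hC₀ : 0 < C₀)
    (hubd : ∀ k, ∀ y ∈ S.Ω,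
      S.u k y ≤ C₀ * S.lam k ^ ((n : ℝ) / (S.qk k + 1))
        * (1 + S.lam k * ‖y - S.xk k‖) ^ ((2 : ℝ) - n))
    (k : ℕ) {x : Euc n} (hx : x ∈ S.Ω) :
    HasFDerivAt (S.v k) (∫ y in S.Ω, S.u k y ^ S.qk k • S.Gderiv x y) x ∧
    IntegrableOn (fun y => S.u k y ^ S.qk k • S.Gderiv x y) S.Ω := by
  have h := S.hasFDerivAt_potential hn (S.aestronglyMeasurable_u_rpow k)
    (M := (C₀ * S.lam k ^ ((n : ℝ) / (S.qk k + 1))) ^ S.qk k)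
    (fun y hy => by
      rw [abs_of_nonneg (Real.rpow_nonneg (S.hu_pos k y hy).le _)]
      exact S.u_rpow_le hC₀ hubd hn hy) hx
  refine ⟨h.1.congr_of_eventuallyEq ?_, h.2⟩
  filter_upwards [S.hΩo.mem_nhds hx] with z hz using S.hv_eq k z hz

end BlowupSetup

/-- Sharp estimate of `v_k` and its gradient on the annulus `|x - x_k| = 2 d_k`
in terms of the Green function, for `n/(n-2) < p ≤ (n+2)/(n-2)`. -/
theorem v_estimate_on_annulus
    (n : ℕ) (hn : 3 ≤ n) (S : BlowupSetup n)
    (hp_low : (n : ℝ) / ((n : ℝ) - 2) < S.p)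
    (hp_high : S.p ≤ ((n : ℝ) + 2) / ((n : ℝ) - 2))
    (hd0 : Filter.Tendsto S.d Filter.atTop (nhds 0))
    (C₀ : ℝ) (hC₀ : 0 < C₀)
    (hubd : ∀ k, ∀ y ∈ S.Ω,
      S.u k y ≤ C₀ * S.lam k ^ ((n : ℝ) / (S.qk k + 1))
        * (1 + S.lam k * ‖y - S.xk k‖) ^ ((2 : ℝ) - n))
    (U : Euc n → ℝ) (hUc : Continuous U) (hUpos : ∀ x, 0 < U x)
    (hUbd : ∀ x, U x ≤ C₀ * (1 + ‖x‖) ^ ((2 : ℝ) - n))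
    (hUlim : ∀ x : Euc n,
      Filter.Tendsto
        (fun k => S.lam k ^ (-((n : ℝ) / (S.qk k + 1))) * S.u k ((S.lam k)⁻¹ • x + S.xk k))
        Filter.atTop (nhds (U x)))
    (AU : ℝ) (hAU : AU = ∫ y, (U y) ^ S.q) :
    (∀ k, DifferentiableOn ℝ (S.v k) S.Ω) ∧
    ∃ η : ℕ → ℝ, (∀ k, 0 ≤ η k) ∧ Filter.Tendsto η Filter.atTop (nhds 0) ∧
      ∀ k, ∀ x : Euc n, ‖x - S.xk k‖ = 2 * S.d k →
        |S.v k x - AU * S.lam k ^ (-((n : ℝ) / (S.qk k + 1))) * S.G x (S.xk k)|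
            ≤ η k * S.lam k ^ (-((n : ℝ) / (S.q + 1))) * S.d k ^ (-((n : ℝ) - 2)) ∧
        ‖gradient (S.v k) x
            - (AU * S.lam k ^ (-((n : ℝ) / (S.qk k + 1)))) •
                gradient (fun z => S.G z (S.xk k)) x‖
            ≤ η k * S.lam k ^ (-((n : ℝ) / (S.q + 1))) * S.d k ^ (-((n : ℝ) - 1)) := by
  have hn' : (3 : ℝ) ≤ n := by exact_mod_cast hn
  have hq := S.dim_lt_mul_q hn hp_high
  refine ⟨fun k x hx =>
    (S.hasFDerivAt_v hn hC₀ hubd k hx).1.differentiableAt.differentiableWithinAt, ?_⟩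
  obtain ⟨K₁, hK₁, hG⟩ := S.exists_G_estimates hn
  obtain ⟨K₂, hK₂, hD⟩ := S.exists_Gderiv_estimates hn
  obtain ⟨C₁, hC₁, hI₁⟩ := exists_integral_norm_rpow_le (n := n) (by omega)
    (s := (n : ℝ) - 2) (by linarith) (by linarith)
  obtain ⟨C₂, hC₂, hI₂⟩ := exists_integral_norm_rpow_le (n := n) (by omega)
    (s := (n : ℝ) - 1) (by linarith) (by linarith)
  set M : ℝ := 16 * K₁ * (1 + C₁) + 16 * K₂ * (1 + C₂) with hM
  have hM0 : 0 ≤ M := by positivity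
  have herr0 : ∀ k, 0 ≤ S.annulusError C₀ AU k := S.annulusError_nonneg hn hC₀ AU
  have herr : Tendsto (S.annulusError C₀ AU) atTop (𝓝 0) := by
    rw [hAU]
    exact S.tendsto_annulusError hC₀ hubd hn hq hUpos hUlim
  have hlam : ∀ k, S.lam k ^ (-((n : ℝ) / (S.qk k + 1)))
      = S.lam k ^ (-((n : ℝ) * S.eps k)) * S.lam k ^ (-((n : ℝ) / (S.q + 1))) := by
    intro k
    rw [← Real.rpow_add (S.lam_pos k)]
    congr 1
    have h1 := S.one_div_qk_add_one k
    rw [div_eq_mul_one_div, h1]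
    ring
  have hη0 : ∀ k, 0 ≤ M * S.annulusError C₀ AU k * S.lam k ^ (-((n : ℝ) * S.eps k)) := by
    intro k
    have := herr0 k
    have := (S.lam_pos k).le
    positivity
  refine ⟨fun k => M * S.annulusError C₀ AU k * S.lam k ^ (-((n : ℝ) * S.eps k)), hη0, ?_, ?_⟩
  · have h1 : Tendsto (fun k => M * S.annulusError C₀ AU k) atTop (𝓝 0) := by
      simpa using herr.const_mul M
    refine squeeze_zero' (Eventually.of_forall hη0) ?_ h1
    filter_upwards [S.hlam_top.eventually_ge_atTop 1] with k hk
    refine mul_le_of_le_one_right (mul_nonneg hM0 (herr0 k)) ?_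
    refine Real.rpow_le_one_of_one_le_of_nonpos hk ?_
    have := S.heps k
    have : 0 ≤ (n : ℝ) * S.eps k := by positivity
    linarith
  intro k x hx
  have hd := S.d_pos hn k
  have hl := S.lam_pos k
  have hbx := S.ball_subset_of_norm_sub_eq hn hx
  have hbz : ball (S.xk k) (2 * S.d k) ⊆ S.Ω :=
    (ball_subset_ball (by linarith)).trans (S.ball_xk_subset hn k)
  have hxO : x ∈ S.Ω := hbx (mem_ball_self (by positivity))
  have hne : x ≠ S.xk k := by
    intro h
    rw [h, sub_self, norm_zero] at hx
    linarith
  have hbound : ∀ (a b : ℝ), 0 ≤ b → a ≤ M → a * S.annulusError C₀ AU k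
      * S.lam k ^ (-((n : ℝ) / (S.qk k + 1))) * b
      ≤ M * S.annulusError C₀ AU k * S.lam k ^ (-((n : ℝ) * S.eps k))
        * S.lam k ^ (-((n : ℝ) / (S.q + 1))) * b := by
    intro a b hb ha
    have := herr0 k
    rw [hlam k, ← mul_assoc (a * S.annulusError C₀ AU k)]
    gcongr
  have hM₁ : 16 * K₁ * (1 + C₁) ≤ M := le_add_of_nonneg_right (by positivity)
  have hM₂ : 16 * K₂ * (1 + C₂) ≤ M := le_add_of_nonneg_left (by positivity)
  constructor
  · obtain ⟨hT1, hT2⟩ := hG x (S.xk k) (S.d k) hd hbx hbz hx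
    have hv : S.v k x = ∫ y in S.Ω, S.u k y ^ S.qk k • S.G x y := by
      rw [S.hv_eq k x hxO]
      simp_rw [smul_eq_mul, mul_comm]
    have hT : IntegrableOn (fun y => S.u k y ^ S.qk k • S.G x y) S.Ω :=
      Integrable.of_integral_ne_zero (hv ▸ (S.hv_pos k x hxO).ne')
    have h := S.norm_setIntegral_smul_sub_le_annulusError hn hC₀ hubd (A := AU) hK₁ hC₁
      (by linarith) hx hT hT1 hT2 (hI₁ x x _ hd).1 (hI₁ x x _ hd).2
    rw [← hv, smul_eq_mul, Real.norm_eq_abs] at h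
    exact h.trans (hbound _ _ (by positivity) hM₁)
  · obtain ⟨hT1, hT2⟩ := hD x (S.xk k) (S.d k) hd hbx hbz hx
    obtain ⟨hv, hT⟩ := S.hasFDerivAt_v hn hC₀ hubd k hxO
    have h := S.norm_setIntegral_smul_sub_le_annulusError hn hC₀ hubd (A := AU) hK₂ hC₂
      (by linarith) hx hT hT1 hT2 (hI₂ x x _ hd).1 (hI₂ x x _ hd).2
    have hgrad : gradient (S.v k) x - (AU * S.lam k ^ (-((n : ℝ) / (S.qk k + 1)))) •
        gradient (fun z => S.G z (S.xk k)) x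
        = (InnerProductSpace.toDual ℝ (Euc n)).symm ((∫ y in S.Ω, S.u k y ^ S.qk k • S.Gderiv x y)
          - (AU * S.lam k ^ (-((n : ℝ) / (S.qk k + 1)))) • S.Gderiv x (S.xk k)) := by
      unfold gradient
      rw [hv.fderiv, (S.hasFDerivAt_G hxO (S.hxk k) hne).fderiv, map_sub]
      congr 1
      simp
    rw [hgrad, LinearIsometryEquiv.norm_map]
    exact h.trans (hbound _ _ (by positivity) hM₂)
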